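/- Let k ≥ 1 be odd, s ≥ 2 even, and c ∈ {0,1}. Then an F-basis of the generalized Reynolds ideal T₁(A^{k,s}_c)^⊥ is given by 𝓝' ∪ {(αβγ)^i + (βγα)^i + (γαβ)^i : (k+1)/2 ≤ i ≤ k−1} ∪ {(αβγ)^k} ∪ {η^j : s/2 + 1 ≤ j ≤ s}, where 𝓝' = {η^{s/2}} if c = 0 and 𝓝' = {η^{s/2} + (βγα)^{k−1}βγ} if c = 1. -/

import Mathlib

/- Common setup: the algebras D(2B)^{k,s}(c) of dihedral type, over a field F,
   presented as a quotient of the free algebra on the paths-generators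
   e₁, e₂ (trivial paths), α (loop at vertex 1), β (arrow 1 → 2),
   γ (arrow 2 → 1), η (loop at vertex 2), by the path-algebra relations
   together with Erdmann's relations
   βη = 0, ηγ = 0, γβ = 0, α² = c(αβγ)^k, (αβγ)^k = (βγα)^k, η^s = (γαβ)^k. -/

noncomputable section

namespace DihedralPaper

inductive Gen : Type
  | e1 | e2 | a | b | g | h

variable (F : Type) [Field F]

/-- The generators inside the free algebra. -/
def gen (t : Gen) : FreeAlgebra F Gen := FreeAlgebra.ι F t

/-- The defining relations of `D(2B)^{k,s}(c)` (paths written from left to right). -/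
inductive Rel (k s : ℕ) (c : F) : FreeAlgebra F Gen → FreeAlgebra F Gen → Prop
  | unit : Rel k s c (gen F .e1 + gen F .e2) 1
  | idem1 : Rel k s c (gen F .e1 * gen F .e1) (gen F .e1)
  | idem2 : Rel k s c (gen F .e2 * gen F .e2) (gen F .e2)
  | orth12 : Rel k s c (gen F .e1 * gen F .e2) 0
  | orth21 : Rel k s c (gen F .e2 * gen F .e1) 0
  | aL : Rel k s c (gen F .e1 * gen F .a) (gen F .a)
  | aR : Rel k s c (gen F .a * gen F .e1) (gen F .a)
  | bL : Rel k s c (gen F .e1 * gen F .b) (gen F .b)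
  | bR : Rel k s c (gen F .b * gen F .e2) (gen F .b)
  | gL : Rel k s c (gen F .e2 * gen F .g) (gen F .g)
  | gR : Rel k s c (gen F .g * gen F .e1) (gen F .g)
  | hL : Rel k s c (gen F .e2 * gen F .h) (gen F .h)
  | hR : Rel k s c (gen F .h * gen F .e2) (gen F .h)
  | bh : Rel k s c (gen F .b * gen F .h) 0
  | hg : Rel k s c (gen F .h * gen F .g) 0
  | gb : Rel k s c (gen F .g * gen F .b) 0
  | asq : Rel k s c (gen F .a * gen F .a) (c • (gen F .a * gen F .b * gen F .g) ^ k)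
  | abg : Rel k s c ((gen F .a * gen F .b * gen F .g) ^ k) ((gen F .b * gen F .g * gen F .a) ^ k)
  | hs : Rel k s c ((gen F .h) ^ s) ((gen F .g * gen F .a * gen F .b) ^ k)

/-- The algebra `A^{k,s}_c = D(2B)^{k,s}(c)`. -/
def DA (k s : ℕ) (c : F) : Type := RingQuot (Rel F k s c)

instance (k s : ℕ) (c : F) : Ring (DA F k s c) :=
  inferInstanceAs (Ring (RingQuot (Rel F k s c)))

instance (k s : ℕ) (c : F) : Algebra F (DA F k s c) :=
  inferInstanceAs (Algebra F (RingQuot (Rel F k s c)))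

variable (k s : ℕ) (c : F)

/-- The canonical projection. -/
def mk : FreeAlgebra F Gen →ₐ[F] DA F k s c := RingQuot.mkAlgHom F (Rel F k s c)

def E1 : DA F k s c := mk F k s c (gen F .e1)
def E2 : DA F k s c := mk F k s c (gen F .e2)
/-- The image of the loop α at vertex 1. -/
def Al : DA F k s c := mk F k s c (gen F .a)
/-- The image of the arrow β : 1 → 2. -/
def Be : DA F k s c := mk F k s c (gen F .b)
/-- The image of the arrow γ : 2 → 1. -/
def Ga : DA F k s c := mk F k s c (gen F .g)
/-- The image of the loop η at vertex 2. -/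
def Et : DA F k s c := mk F k s c (gen F .h)

/-- The path αβγ. -/
def ABG : DA F k s c := Al F k s c * Be F k s c * Ga F k s c
/-- The path βγα. -/
def BGA : DA F k s c := Be F k s c * Ga F k s c * Al F k s c
/-- The path γαβ. -/
def GAB : DA F k s c := Ga F k s c * Al F k s c * Be F k s c

/-- The standard basis paths 𝓑₁₁ of e₁Ae₁. -/
def B11 : Set (DA F k s c) :=
  {E1 F k s c, Al F k s c, Be F k s c * Ga F k s c, (ABG F k s c) ^ k}
    ∪ (fun i => (ABG F k s c) ^ i) '' Set.Icc 1 (k - 1)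
    ∪ (fun i => (ABG F k s c) ^ i * Al F k s c) '' Set.Icc 1 (k - 1)
    ∪ (fun i => (BGA F k s c) ^ i) '' Set.Icc 1 (k - 1)
    ∪ (fun i => (BGA F k s c) ^ i * (Be F k s c * Ga F k s c)) '' Set.Icc 1 (k - 1)

/-- The standard basis paths 𝓑₁₂ of e₁Ae₂. -/
def B12 : Set (DA F k s c) :=
  {Be F k s c, Al F k s c * Be F k s c}
    ∪ (fun i => (BGA F k s c) ^ i * Be F k s c) '' Set.Icc 1 (k - 1)
    ∪ (fun i => (ABG F k s c) ^ i * (Al F k s c * Be F k s c)) '' Set.Icc 1 (k - 1)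

/-- The standard basis paths 𝓑₂₁ of e₂Ae₁. -/
def B21 : Set (DA F k s c) :=
  {Ga F k s c, Ga F k s c * Al F k s c}
    ∪ (fun i => (GAB F k s c) ^ i * Ga F k s c) '' Set.Icc 1 (k - 1)
    ∪ (fun i => (GAB F k s c) ^ i * (Ga F k s c * Al F k s c)) '' Set.Icc 1 (k - 1)

/-- The standard basis paths 𝓑₂₂ of e₂Ae₂. -/
def B22 : Set (DA F k s c) :=
  {E2 F k s c}
    ∪ (fun i => (GAB F k s c) ^ i) '' Set.Icc 1 (k - 1)
    ∪ (fun j => (Et F k s c) ^ j) '' Set.Icc 1 s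

/-- The standard path basis 𝓑 of `A^{k,s}_c`. -/
def BB : Set (DA F k s c) :=
  B11 F k s c ∪ B12 F k s c ∪ B21 F k s c ∪ B22 F k s c

/-- The commutator subspace K(A): the F-linear span of all commutators. -/
def Kspan (A : Type) [Ring A] [Algebra F A] : Submodule F A :=
  Submodule.span F {z : A | ∃ u v : A, z = u * v - v * u}

/-- The (left) socle of a ring: the sum of all simple (left) submodules. -/
def socle (A : Type) [Ring A] : Submodule A A := sSup {S : Submodule A A | IsAtom S}

/-- `ψ` is the linear form sending each standard basis path lying in the socle to 1
    and every other standard basis path to 0. -/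
def SoclePsi (ψ : DA F k s c →ₗ[F] F) : Prop :=
  ∀ p ∈ BB F k s c,
    (p ∈ socle (DA F k s c) → ψ p = 1) ∧ (p ∉ socle (DA F k s c) → ψ p = 0)

/-- `T₁(A) = {x : x² ∈ K(A)}`. -/
def T1set : Set (DA F k s c) := {z | z ^ 2 ∈ Kspan F (DA F k s c)}

/-- The orthogonal space `T₁(A)^⊥` with respect to the form `⟨x, y⟩ = ψ(xy)`. -/
def T1perp (ψ : DA F k s c →ₗ[F] F) : Set (DA F k s c) :=
  {y | ∀ x ∈ T1set F k s c, ψ (y * x) = 0}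

/-- The first generalized Reynolds ideal, as an ideal of the center `Z(A)`. -/
def ReynoldsIdeal (ψ : DA F k s c →ₗ[F] F) :
    Ideal (Subalgebra.center F (DA F k s c)) :=
  Ideal.span {z : Subalgebra.center F (DA F k s c) | (z : DA F k s c) ∈ T1perp F k s c ψ}


open Classical in
/-- The set 𝓝′ (case `k` odd, `s` even). -/
def Np : Set (DA F k s c) :=
  if c = 0 then {(Et F k s c) ^ (s / 2)}
  else {(Et F k s c) ^ (s / 2)
          + (BGA F k s c) ^ (k - 1) * (Be F k s c * Ga F k s c)}

/-- The claimed basis 𝓣^⊥ of `T₁(A^{k,s}_c)^⊥` (case `k` odd, `s` even). -/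
def TP : Set (DA F k s c) :=
  Np F k s c
    ∪ (fun i => (ABG F k s c) ^ i + (BGA F k s c) ^ i + (GAB F k s c) ^ i) ''
        Set.Icc ((k + 1) / 2) (k - 1)
    ∪ {(ABG F k s c) ^ k}
    ∪ (fun j => (Et F k s c) ^ j) '' Set.Icc (s / 2 + 1) s

section Abstract

/-- The arrows `α`, `β`, `γ`, in cyclic order. -/
def arr {B : Type} (x : Gen → B) (t : ZMod 3) : B :=
  if t = 0 then x .a else if t = 1 then x .b else x .g

/-- The trivial path at the target of `arr x t`. -/
def eps {B : Type} (x : Gen → B) (t : ZMod 3) : B := if t = 1 then x .e2 else x .e1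

lemma zmod3_cases (t : ZMod 3) : t = 0 ∨ t = 1 ∨ t = 2 := by
  revert t; decide

lemma cast_three_mul (i : ℕ) : ((3 * i : ℕ) : ZMod 3) = 0 := by
  rw [Nat.cast_mul]
  exact mul_eq_zero_of_left (by decide) _

@[simp] lemma arr_zero {B : Type} (x : Gen → B) : arr x 0 = x .a := rfl
@[simp] lemma arr_one {B : Type} (x : Gen → B) : arr x 1 = x .b := rfl
@[simp] lemma arr_two {B : Type} (x : Gen → B) : arr x 2 = x .g := rfl
@[simp] lemma eps_zero {B : Type} (x : Gen → B) : eps x 0 = x .e1 := rfl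
@[simp] lemma eps_one {B : Type} (x : Gen → B) : eps x 1 = x .e2 := rfl
@[simp] lemma eps_two {B : Type} (x : Gen → B) : eps x 2 = x .e1 := rfl

variable {F k s c} {A : Type} [Ring A] [Algebra F A]

/-- A family of generators of an `F`-algebra satisfying the defining relations of
`D(2B)^{k,s}(c)`. -/
structure IsDihedral (k s : ℕ) (c : F) (x : Gen → A) : Prop where
  unit : x .e1 + x .e2 = 1
  idem1 : x .e1 * x .e1 = x .e1
  idem2 : x .e2 * x .e2 = x .e2
  orth12 : x .e1 * x .e2 = 0
  orth21 : x .e2 * x .e1 = 0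
  aL : x .e1 * x .a = x .a
  aR : x .a * x .e1 = x .a
  bL : x .e1 * x .b = x .b
  bR : x .b * x .e2 = x .b
  gL : x .e2 * x .g = x .g
  gR : x .g * x .e1 = x .g
  hL : x .e2 * x .h = x .h
  hR : x .h * x .e2 = x .h
  bh : x .b * x .h = 0
  hg : x .h * x .g = 0
  gb : x .g * x .b = 0
  asq : x .a * x .a = c • (x .a * x .b * x .g) ^ k
  abg : (x .a * x .b * x .g) ^ k = (x .b * x .g * x .a) ^ k
  hs : x .h ^ s = (x .g * x .a * x .b) ^ k
  adjoin_eq : Algebra.adjoin F (Set.range x) = ⊤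

/-- The path of length `m` that follows the cycle `α, β, γ` and ends with `arr x t`. -/
def word (x : Gen → A) (t : ZMod 3) : ℕ → A
  | 0 => eps x t
  | m + 1 => arr x (t - m) * word x t m

@[simp] lemma word_zero (x : Gen → A) (t : ZMod 3) : word x t 0 = eps x t := rfl

lemma word_succ (x : Gen → A) (t : ZMod 3) (m : ℕ) :
    word x t (m + 1) = arr x (t - m) * word x t m := rfl

namespace IsDihedral

variable {x : Gen → A} (H : IsDihedral k s c x)
include H

lemma e1_h : x .e1 * x .h = 0 := by
  rw [← H.hL, ← mul_assoc, H.orth12, zero_mul]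

lemma h_e1 : x .h * x .e1 = 0 := by
  rw [← H.hR, mul_assoc, H.orth21, mul_zero]

lemma e2_a : x .e2 * x .a = 0 := by
  rw [← H.aL, ← mul_assoc, H.orth21, zero_mul]

lemma a_e2 : x .a * x .e2 = 0 := by
  rw [← H.aR, mul_assoc, H.orth12, mul_zero]

lemma e2_b : x .e2 * x .b = 0 := by
  rw [← H.bL, ← mul_assoc, H.orth21, zero_mul]

lemma b_e1 : x .b * x .e1 = 0 := by
  rw [← H.bR, mul_assoc, H.orth21, mul_zero]

lemma e1_g : x .e1 * x .g = 0 := by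
  rw [← H.gL, ← mul_assoc, H.orth12, zero_mul]

lemma g_e2 : x .g * x .e2 = 0 := by
  rw [← H.gR, mul_assoc, H.orth12, mul_zero]

lemma arr_eps (t : ZMod 3) : arr x t * eps x t = arr x t := by
  rcases zmod3_cases t with rfl | rfl | rfl <;> simp [H.aR, H.bR, H.gR]

lemma eps_arr (t : ZMod 3) : eps x (t - 1) * arr x t = arr x t := by
  rcases zmod3_cases t with rfl | rfl | rfl
  · exact H.aL
  · exact H.bL
  · exact H.gL

lemma arr_mul_eps (t u : ZMod 3) : arr x t * eps x u = arr x t ∨ arr x t * eps x u = 0 := by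
  rcases zmod3_cases t with rfl | rfl | rfl <;> rcases zmod3_cases u with rfl | rfl | rfl <;>
    simp [H.aR, H.bR, H.gR, H.a_e2, H.b_e1, H.g_e2]

lemma eps_mul_arr (t u : ZMod 3) : eps x u * arr x t = arr x t ∨ eps x u * arr x t = 0 := by
  rcases zmod3_cases t with rfl | rfl | rfl <;> rcases zmod3_cases u with rfl | rfl | rfl <;>
    simp [H.aL, H.bL, H.gL, H.e2_a, H.e2_b, H.e1_g]

lemma eps_mul_self (t : ZMod 3) : eps x t * eps x t = eps x t := by
  rcases zmod3_cases t with rfl | rfl | rfl <;> simp [H.idem1, H.idem2]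

lemma eps_mul_eps (t u : ZMod 3) : eps x u * eps x t = eps x t ∨ eps x u * eps x t = 0 := by
  rcases zmod3_cases t with rfl | rfl | rfl <;> rcases zmod3_cases u with rfl | rfl | rfl <;>
    simp [H.idem1, H.idem2, H.orth12, H.orth21]

lemma eps_comm (t u : ZMod 3) : eps x u * eps x t = eps x t * eps x u := by
  rcases zmod3_cases t with rfl | rfl | rfl <;> rcases zmod3_cases u with rfl | rfl | rfl <;>
    simp [H.orth12, H.orth21]

lemma arr_mul_arr {t u : ZMod 3} (h : u ≠ t + 1) (h' : ¬ (t = 0 ∧ u = 0)) :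
    arr x t * arr x u = 0 := by
  have bb : x .b * x .b = 0 := by
    nth_rw 2 [← H.bL]
    rw [← mul_assoc, H.b_e1, zero_mul]
  have ba : x .b * x .a = 0 := by rw [← H.aL, ← mul_assoc, H.b_e1, zero_mul]
  have gg : x .g * x .g = 0 := by
    nth_rw 2 [← H.gL]
    rw [← mul_assoc, H.g_e2, zero_mul]
  have ag : x .a * x .g = 0 := by rw [← H.gL, ← mul_assoc, H.a_e2, zero_mul]
  rcases zmod3_cases t with rfl | rfl | rfl <;> rcases zmod3_cases u with rfl | rfl | rfl <;>
    first
      | exact absurd (by decide) h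
      | exact absurd (by decide) h'
      | simp [bb, ba, gg, ag, H.gb]

lemma h_mul_arr (t : ZMod 3) : x .h * arr x t = 0 := by
  rcases zmod3_cases t with rfl | rfl | rfl
  · rw [arr_zero, ← H.aL, ← mul_assoc, H.h_e1, zero_mul]
  · rw [arr_one, ← H.bL, ← mul_assoc, H.h_e1, zero_mul]
  · exact H.hg

lemma arr_mul_h (t : ZMod 3) : arr x t * x .h = 0 := by
  rcases zmod3_cases t with rfl | rfl | rfl
  · rw [arr_zero, ← H.aR, mul_assoc, H.e1_h, mul_zero]
  · exact H.bh
  · rw [arr_two, ← H.gR, mul_assoc, H.e1_h, mul_zero]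

lemma eps_mul_h (t : ZMod 3) :
    eps x t * x .h = x .h * eps x t ∧ (eps x t * x .h = x .h ∨ eps x t * x .h = 0) := by
  rcases zmod3_cases t with rfl | rfl | rfl <;> simp [H.e1_h, H.h_e1, H.hL, H.hR]

lemma word_succ' (t : ZMod 3) (m : ℕ) : word x t (m + 1) = word x (t - 1) m * arr x t := by
  induction m with
  | zero => simp [word_succ, H.arr_eps, H.eps_arr]
  | succ m ih =>
    rw [word_succ, ih, word_succ, mul_assoc]
    congr 2
    push_cast; ring

lemma eps_word (t : ZMod 3) (m : ℕ) : eps x (t - m) * word x t m = word x t m := by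
  cases m with
  | zero => simp [H.eps_mul_self]
  | succ m =>
    rw [word_succ, ← mul_assoc]
    congr 1
    convert H.eps_arr (t - m) using 3
    push_cast; ring

lemma word_mul (t : ZMod 3) (m n : ℕ) : word x (t - m) n * word x t m = word x t (m + n) := by
  induction n with
  | zero => exact H.eps_word t m
  | succ n ih =>
    rw [word_succ, mul_assoc, ih, ← add_assoc, word_succ]
    congr 2
    push_cast; ring

lemma word_mul' {t u : ZMod 3} {m : ℕ} (h : u = t - m) (n : ℕ) :
    word x u n * word x t m = word x t (m + n) := by
  rw [h, H.word_mul]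

lemma word_three_mul (t : ZMod 3) {i : ℕ} (hi : 1 ≤ i) :
    word x t (3 * i) = word x t 3 ^ i := by
  induction i, hi using Nat.le_induction with
  | base => simp
  | succ i _ ih =>
    rw [pow_succ, ← ih, mul_add, mul_one, add_comm]
    exact (H.word_mul' (by rw [show ((3 : ℕ) : ZMod 3) = 0 from rfl, sub_zero]) _).symm

lemma word_two_three : word x 2 3 = x .a * x .b * x .g := by
  rw [H.word_succ', H.word_succ', H.word_succ']
  change x .e1 * x .a * x .b * x .g = _
  rw [H.aL]

lemma word_zero_three : word x 0 3 = x .b * x .g * x .a := by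
  rw [H.word_succ', H.word_succ', H.word_succ']
  change x .e1 * x .b * x .g * x .a = _
  rw [H.bL]

lemma word_one_three : word x 1 3 = x .g * x .a * x .b := by
  rw [H.word_succ', H.word_succ', H.word_succ']
  change x .e2 * x .g * x .a * x .b = _
  rw [H.gL]

lemma word_top (hk : 1 ≤ k) : word x 0 (3 * k) = word x 2 (3 * k) := by
  rw [H.word_three_mul _ hk, H.word_three_mul _ hk, H.word_two_three, H.word_zero_three, H.abg]

lemma word_one_top (hk : 1 ≤ k) : word x 1 (3 * k) = x .h ^ s := by
  rw [H.word_three_mul _ hk, H.word_one_three, H.hs]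

lemma a_mul_a (hk : 1 ≤ k) : arr x 0 * arr x 0 = c • word x 2 (3 * k) := by
  rw [H.word_three_mul _ hk, H.word_two_three]
  exact H.asq

lemma h_mul_word (t : ZMod 3) {m : ℕ} (hm : 1 ≤ m) : x .h * word x t m = 0 := by
  obtain ⟨m, rfl⟩ := Nat.exists_eq_add_of_le' hm
  rw [word_succ, ← mul_assoc, H.h_mul_arr, zero_mul]

lemma word_mul_h (t : ZMod 3) {m : ℕ} (hm : 1 ≤ m) : word x t m * x .h = 0 := by
  obtain ⟨m, rfl⟩ := Nat.exists_eq_add_of_le' hm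
  rw [H.word_succ', mul_assoc, H.arr_mul_h, mul_zero]

lemma pow_mul_word (t : ZMod 3) {j m : ℕ} (hj : 1 ≤ j) (hm : 1 ≤ m) :
    x .h ^ j * word x t m = 0 := by
  obtain ⟨j, rfl⟩ := Nat.exists_eq_add_of_le' hj
  rw [pow_succ, mul_assoc, H.h_mul_word t hm, mul_zero]

lemma word_mul_pow (t : ZMod 3) {j m : ℕ} (hj : 1 ≤ j) (hm : 1 ≤ m) :
    word x t m * x .h ^ j = 0 := by
  obtain ⟨j, rfl⟩ := Nat.exists_eq_add_of_le' hj
  rw [pow_succ', ← mul_assoc, H.word_mul_h t hm, zero_mul]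

lemma arr_mul_pow (t : ZMod 3) {j : ℕ} (hj : 1 ≤ j) : arr x t * x .h ^ j = 0 := by
  obtain ⟨j, rfl⟩ := Nat.exists_eq_add_of_le' hj
  rw [pow_succ', ← mul_assoc, H.arr_mul_h t, zero_mul]

lemma pow_mul_arr (t : ZMod 3) {j : ℕ} (hj : 1 ≤ j) : x .h ^ j * arr x t = 0 := by
  obtain ⟨j, rfl⟩ := Nat.exists_eq_add_of_le' hj
  rw [pow_succ, mul_assoc, H.h_mul_arr t, mul_zero]

lemma eps_mul_pow (t : ZMod 3) {j : ℕ} (hj : 1 ≤ j) :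
    eps x t * x .h ^ j = x .h ^ j * eps x t ∧
      (eps x t * x .h ^ j = x .h ^ j ∨ eps x t * x .h ^ j = 0) := by
  obtain ⟨h1, h2⟩ := H.eps_mul_h t
  refine ⟨(show Commute _ _ from h1).pow_right j, ?_⟩
  obtain ⟨j, rfl⟩ := Nat.exists_eq_add_of_le' hj
  rw [pow_succ', ← mul_assoc]
  rcases h2 with h | h <;> simp [h]

/-- Words that do not concatenate along the cycle have product zero, unless `α * α` occurs. -/
lemma word_mul_of_ne {t u : ZMod 3} {m n : ℕ} (hm : 1 ≤ m) (hn : 1 ≤ n) (h : u ≠ t - m)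
    (h' : ¬ (u = 0 ∧ t - m = -1)) : word x u n * word x t m = 0 := by
  obtain ⟨m, rfl⟩ := Nat.exists_eq_add_of_le' hm
  obtain ⟨n, rfl⟩ := Nat.exists_eq_add_of_le' hn
  rw [H.word_succ' u, word_succ, mul_assoc, ← mul_assoc (arr x u), H.arr_mul_arr, zero_mul,
    mul_zero]
  · intro h1
    apply h
    push_cast
    linear_combination -h1
  · rintro ⟨h1, h2⟩
    apply h'
    refine ⟨h1, ?_⟩
    push_cast
    linear_combination h2

lemma arr_mul_top (hk : 1 ≤ k) (hs : 1 ≤ s) (u t : ZMod 3) : arr x u * word x t (3 * k) = 0 := by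
  have e : 3 * k = (3 * k - 1) + 1 := by omega
  have hc : ((3 * k - 1 : ℕ) : ZMod 3) = -1 := by
    have := cast_three_mul k
    rw [e] at this
    push_cast at this
    linear_combination this
  have h0 : arr x 0 * word x 2 (3 * k) = 0 := by
    rw [e, word_succ, ← mul_assoc, hc, show (2 - -1 : ZMod 3) = 0 by decide, H.a_mul_a hk,
      smul_mul_assoc, H.word_mul_of_ne (by omega) (by omega) _ _, smul_zero]
    · rw [hc]; decide
    · rw [hc]; decide
  have h2 : arr x 2 * word x 0 (3 * k) = 0 := by
    rw [e, word_succ, ← mul_assoc, hc, H.arr_mul_arr (by decide) (by decide), zero_mul]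
  have key (u t : ZMod 3) (h : u ≠ t) (h' : ¬ (u = 0 ∧ t = 2)) :
      arr x u * word x t (3 * k) = 0 := by
    rw [e, word_succ, ← mul_assoc, hc, H.arr_mul_arr, zero_mul]
    · intro h1
      exact h (by linear_combination -h1)
    · rintro ⟨h1, h2⟩
      refine h' ⟨h1, ?_⟩
      rw [show (2 : ZMod 3) = -1 by decide]
      linear_combination h2
  rcases zmod3_cases t with rfl | rfl | rfl <;> rcases zmod3_cases u with rfl | rfl | rfl
  · rw [H.word_top hk, h0]
  · exact key _ _ (by decide) (by decide)
  · exact h2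
  · exact key _ _ (by decide) (by decide)
  · rw [H.word_one_top hk, H.arr_mul_pow _ hs]
  · exact key _ _ (by decide) (by decide)
  · exact h0
  · exact key _ _ (by decide) (by decide)
  · rw [← H.word_top hk, h2]

lemma word_eq_zero (hk : 1 ≤ k) (hs : 1 ≤ s) (t : ZMod 3) {m : ℕ} (hm : 3 * k < m) :
    word x t m = 0 := by
  induction m, hm using Nat.le_induction with
  | base => rw [Nat.succ_eq_add_one, word_succ, H.arr_mul_top hk hs]
  | succ m _ ih => rw [word_succ, ih, mul_zero]

lemma pow_eq_zero_of_lt (hk : 1 ≤ k) {j : ℕ} (hj : s < j) : x .h ^ j = 0 := by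
  obtain ⟨i, rfl⟩ := Nat.exists_eq_add_of_lt hj
  rw [add_right_comm, pow_add, pow_succ', ← H.word_one_top hk,
    H.h_mul_word _ (by omega), zero_mul]

lemma top_mul_word (hk : 1 ≤ k) (hs : 1 ≤ s) (u t : ZMod 3) {m : ℕ} (hm : 1 ≤ m) :
    word x u (3 * k) * word x t m = 0 := by
  by_cases h : u = t - m
  · rw [H.word_mul' h, H.word_eq_zero hk hs _ (by omega)]
  by_cases h2 : u = 0 ∧ t - m = -1
  · rw [h2.1, H.word_top hk, H.word_mul' (by rw [h2.2]; decide), H.word_eq_zero hk hs _ (by omega)]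
  · exact H.word_mul_of_ne hm (by omega) h h2

/-- The product of two nontrivial words that do not concatenate along the cycle. -/
lemma word_mul_of_ne' (hk : 1 ≤ k) (hs : 1 ≤ s) {t u : ZMod 3} {m n : ℕ} (hm : 1 ≤ m)
    (hn : 1 ≤ n) (h : u ≠ t - m) :
    word x u n * word x t m =
      if u = 0 ∧ t = 0 ∧ n = 1 ∧ m = 1 then c • word x 2 (3 * k) else 0 := by
  by_cases h' : u = 0 ∧ t - m = -1
  swap
  · rw [H.word_mul_of_ne hm hn h h', if_neg]
    rintro ⟨h1, h2, -, rfl⟩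
    exact h' ⟨h1, by rw [h2]; simp⟩
  obtain ⟨rfl, ht⟩ := h'
  obtain ⟨m, rfl⟩ := Nat.exists_eq_add_of_le' hm
  obtain ⟨n, rfl⟩ := Nat.exists_eq_add_of_le' hn
  have ht' : t - m = 0 := by push_cast at ht; linear_combination ht
  have e : word x 0 (n + 1) * word x t (m + 1) =
      c • (word x (0 - 1) n * word x 2 (3 * k) * word x t m) := by
    rw [H.word_succ' 0, word_succ, ht', mul_assoc, ← mul_assoc (arr x 0), H.a_mul_a hk]
    simp only [smul_mul_assoc, mul_smul_comm, mul_assoc]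
  rw [e]
  rcases Nat.eq_zero_or_pos m with rfl | hm0
  · have ht0 : t = 0 := by simpa using ht'
    subst ht0
    have e2 : word x 2 (3 * k) * word x 0 0 = word x 2 (3 * k) := by
      rw [← H.word_top hk]
      simpa using H.word_mul' (t := 0) (u := 0) (m := 0) (by simp) (3 * k)
    rw [mul_assoc, e2]
    cases n with
    | zero =>
      rw [if_pos (by simp), show (0 - 1 : ZMod 3) = 2 - (3 * k : ℕ) by
        rw [cast_three_mul]; decide, word_zero, H.eps_word]
    | succ n =>
      rw [if_neg (by simp), H.word_succ', mul_assoc, H.arr_mul_top hk hs, mul_zero, smul_zero]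
  · rw [mul_assoc, H.top_mul_word hk hs _ _ hm0, mul_zero, smul_zero, if_neg]
    rintro ⟨-, -, -, h3⟩
    omega

end IsDihedral

/-- The span of the words of length at least `n` and of the powers `η ^ j` with `j ≥ n`. -/
def filt (F : Type) [Field F] {A : Type} [Ring A] [Algebra F A] (x : Gen → A) (n : ℕ) :
    Submodule F A :=
  Submodule.span F
    ({y | ∃ t m, n ≤ m ∧ y = word x t m} ∪ {y | ∃ j, n ≤ j ∧ 1 ≤ j ∧ y = x .h ^ j})

lemma word_mem_filt (x : Gen → A) (t : ZMod 3) {m n : ℕ} (h : n ≤ m) :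
    word x t m ∈ filt F x n :=
  Submodule.subset_span (Or.inl ⟨t, m, h, rfl⟩)

lemma pow_mem_filt (x : Gen → A) {j n : ℕ} (h : n ≤ j) (hj : 1 ≤ j) :
    x .h ^ j ∈ filt F x n :=
  Submodule.subset_span (Or.inr ⟨j, h, hj, rfl⟩)

lemma filt_anti (x : Gen → A) {m n : ℕ} (h : m ≤ n) : filt F x n ≤ filt F x m := by
  refine Submodule.span_mono (Set.union_subset_union ?_ ?_)
  · rintro _ ⟨t, i, hi, rfl⟩
    exact ⟨t, i, by omega, rfl⟩
  · rintro _ ⟨j, hj, h1, rfl⟩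
    exact ⟨j, by omega, h1, rfl⟩

lemma mul_mem_of_mem_filt {x : Gen → A} {n : ℕ} {g y : A} {V : Submodule F A}
    (hw : ∀ t m, n ≤ m → g * word x t m ∈ V) (hp : ∀ j, n ≤ j → 1 ≤ j → g * x .h ^ j ∈ V)
    (hy : y ∈ filt F x n) : g * y ∈ V := by
  induction hy using Submodule.span_induction with
  | mem y hy =>
    rcases hy with ⟨t, m, hm, rfl⟩ | ⟨j, h1, h2, rfl⟩
    · exact hw t m hm
    · exact hp j h1 h2
  | zero => simp
  | add y z _ _ hy hz => rw [mul_add]; exact V.add_mem hy hz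
  | smul r y _ hy => rw [mul_smul_comm]; exact V.smul_mem r hy

namespace IsDihedral

variable {x : Gen → A} (H : IsDihedral k s c x)
include H

/-- Induction over the algebra through its generators. -/
theorem gen_induction {p : A → Prop} (he : ∀ t, p (eps x t)) (ha : ∀ t, p (arr x t))
    (hh : p (x .h)) (hr : ∀ r : F, p (algebraMap F A r)) (hadd : ∀ u v, p u → p v → p (u + v))
    (hmul : ∀ u v, p u → p v → p (u * v)) (u : A) : p u := by
  have hu : u ∈ Algebra.adjoin F (Set.range x) := by rw [H.adjoin_eq]; trivial
  induction hu using Algebra.adjoin_induction with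
  | mem u hu =>
    obtain ⟨i, rfl⟩ := hu
    cases i
    · exact he 0
    · exact he 1
    · exact ha 0
    · exact ha 1
    · exact ha 2
    · exact hh
  | algebraMap r => exact hr r
  | add u v _ _ hu hv => exact hadd u v hu hv
  | mul u v _ _ hu hv => exact hmul u v hu hv

lemma eps_mul_word (t u : ZMod 3) (m : ℕ) :
    eps x u * word x t m = word x t m ∨ eps x u * word x t m = 0 := by
  rw [← H.eps_word, ← mul_assoc]
  rcases H.eps_mul_eps (t - m) u with h | h <;> simp [h]

lemma word_mul_eps (t u : ZMod 3) (m : ℕ) :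
    word x t m * eps x u = word x t m ∨ word x t m * eps x u = 0 := by
  cases m with
  | zero => rw [word_zero, H.eps_comm]; exact H.eps_mul_eps t u
  | succ m =>
    rw [H.word_succ', mul_assoc]
    rcases H.arr_mul_eps t u with h | h <;> simp [h]

lemma arr_mul_word (hk : 1 ≤ k) (hs : 1 ≤ s) (t u : ZMod 3) {m : ℕ} (hm : 1 ≤ m) :
    arr x u * word x t m = if u = t - m then word x t (m + 1) else
      if u = 0 ∧ t = 0 ∧ m = 1 then c • word x 2 (3 * k) else 0 := by
  split_ifs with h1 h2
  · rw [word_succ, h1]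
  all_goals
    have e : arr x u = word x u 1 := by simp [word_succ, H.arr_eps]
    rw [e, H.word_mul_of_ne' hk hs hm le_rfl h1]
    simp [h2]

lemma word_mul_arr (hk : 1 ≤ k) (hs : 1 ≤ s) (t u : ZMod 3) {m : ℕ} (hm : 1 ≤ m) :
    word x t m * arr x u = if u = t + 1 then word x u (m + 1) else
      if u = 0 ∧ t = 0 ∧ m = 1 then c • word x 2 (3 * k) else 0 := by
  have e : arr x u = word x u 1 := by simp [word_succ, H.arr_eps]
  split_ifs with h1 h2
  · rw [H.word_succ', h1, add_sub_cancel_right]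
  all_goals
    rw [e, H.word_mul_of_ne' hk hs le_rfl hm]
    · grind
    · intro h
      apply h1
      rw [h]
      push_cast; ring

lemma arr_mul_mem_filt (hk : 1 ≤ k) (hs : 1 ≤ s) (u : ZMod 3) {n : ℕ} {y : A}
    (hy : y ∈ filt F x n) : arr x u * y ∈ filt F x (n + 1) := by
  refine mul_mem_of_mem_filt (fun t m hm => ?_) (fun j _ hj => ?_) hy
  · rcases Nat.eq_zero_or_pos m with rfl | hm0
    · obtain rfl : n = 0 := by omega
      rw [word_zero]
      rcases H.arr_mul_eps u t with h | h <;> rw [h]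
      · rw [← H.arr_eps]
        simpa [word_succ] using word_mem_filt (F := F) x u (m := 1) (n := 1) le_rfl
      · exact zero_mem _
    · rw [H.arr_mul_word hk hs _ _ hm0]
      split_ifs with h1 h2
      · exact word_mem_filt x t (by omega)
      · exact Submodule.smul_mem _ _ (word_mem_filt x _ (by omega))
      · exact zero_mem _
  · rw [H.arr_mul_pow u hj]
    exact zero_mem _

lemma h_mul_mem_filt {n : ℕ} {y : A} (hy : y ∈ filt F x n) :
    x .h * y ∈ filt F x (n + 1) := by
  refine mul_mem_of_mem_filt (fun t m hm => ?_) (fun j hj _ => ?_) hy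
  · rcases Nat.eq_zero_or_pos m with rfl | hm0
    · obtain rfl : n = 0 := by omega
      obtain ⟨h1, h | h⟩ := H.eps_mul_h t <;> rw [word_zero, ← h1, h]
      · simpa using pow_mem_filt (F := F) x (j := 1) le_rfl le_rfl
      · exact zero_mem _
    · rw [H.h_mul_word t hm0]
      exact zero_mem _
  · rw [← pow_succ']
    exact pow_mem_filt x (by omega) (by omega)

lemma mul_mem_filt (hk : 1 ≤ k) (hs : 1 ≤ s) {n : ℕ} (u : A) :
    ∀ y ∈ filt F x n, u * y ∈ filt F x n := by
  refine H.gen_induction (p := fun u => ∀ y ∈ filt F x n, u * y ∈ filt F x n)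
    (fun u y hy => ?_) (fun u y hy => ?_) (fun y hy => ?_)
    (fun r y hy => ?_) (fun u v hu hv y hy => ?_) (fun u v hu hv y hy => ?_) u
  · refine mul_mem_of_mem_filt (fun t m hm => ?_) (fun j hj hj' => ?_) hy
    · rcases H.eps_mul_word t u m with h | h <;> rw [h]
      · exact word_mem_filt x t hm
      · exact zero_mem _
    · rcases (H.eps_mul_pow u hj').2 with h | h <;> rw [h]
      · exact pow_mem_filt x hj hj'
      · exact zero_mem _
  · exact filt_anti x n.le_succ (H.arr_mul_mem_filt hk hs u hy)
  · exact filt_anti x n.le_succ (H.h_mul_mem_filt hy)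
  · rw [← Algebra.smul_def]
    exact Submodule.smul_mem _ _ hy
  · rw [add_mul]
    exact add_mem (hu y hy) (hv y hy)
  · rw [mul_assoc]
    exact hu _ (hv y hy)

lemma filt_zero (hk : 1 ≤ k) (hs : 1 ≤ s) (u : A) : u ∈ filt F x 0 := by
  rw [← mul_one u]
  refine H.mul_mem_filt hk hs u 1 ?_
  rw [← H.unit]
  exact add_mem (word_mem_filt x 0 (m := 0) le_rfl) (word_mem_filt x 1 (m := 0) le_rfl)

lemma eq_zero_of_mem_filt (hk : 1 ≤ k) (hs : 1 ≤ s) {y : A}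
    (hy : y ∈ filt F x (3 * k + s + 1)) : y = 0 := by
  refine (Submodule.mem_bot F).mp ?_
  rw [← one_mul y]
  refine mul_mem_of_mem_filt (fun t m hm => ?_) (fun j hj _ => ?_) hy
  · rw [H.word_eq_zero hk hs t (by omega), mul_zero]
    exact zero_mem _
  · rw [H.pow_eq_zero_of_lt hk (by omega), mul_zero]
    exact zero_mem _

/-- Induction over the algebra through its standard basis paths. -/
theorem path_induction (hk : 1 ≤ k) (hs : 1 ≤ s) {p : A → Prop}
    (hw : ∀ t m, m ≤ 3 * k → p (word x t m)) (hp : ∀ j, 1 ≤ j → j ≤ s → p (x .h ^ j))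
    (hzero : p 0) (hadd : ∀ u v, p u → p v → p (u + v)) (hsmul : ∀ (r : F) u, p u → p (r • u))
    (u : A) : p u := by
  have hu := H.filt_zero hk hs u
  induction hu using Submodule.span_induction with
  | mem u hu =>
    rcases hu with ⟨t, m, -, rfl⟩ | ⟨j, -, hj, rfl⟩
    · rcases le_or_gt m (3 * k) with h | h
      · exact hw t m h
      · rwa [H.word_eq_zero hk hs t h]
    · rcases le_or_gt j s with h | h
      · exact hp j hj h
      · rwa [H.pow_eq_zero_of_lt hk h]
  | zero => exact hzero
  | add u v _ _ hu hv => exact hadd u v hu hv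
  | smul r u _ hu => exact hsmul r u hu

lemma mul_eq_zero_of_mem_atom (hk : 1 ≤ k) (hs : 1 ≤ s) {g : A}
    (hg : ∀ n, ∀ y ∈ filt F x n, g * y ∈ filt F x (n + 1)) {S : Submodule A A} (hS : IsAtom S)
    {y : A} (hy : y ∈ S) : g * y = 0 := by
  by_contra hne
  have hle : Submodule.span A {g * y} ≤ S := by
    rw [Submodule.span_singleton_le_iff_mem]
    exact S.smul_mem g hy
  have hspan : Submodule.span A {g * y} = S := by
    refine (hS.le_iff.mp hle).resolve_left fun h => hne ?_
    exact Submodule.span_singleton_eq_bot.mp h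
  obtain ⟨u, hu⟩ : ∃ u : A, u • (g * y) = y := by
    rw [← Submodule.mem_span_singleton, hspan]
    exact hy
  have hall (n : ℕ) : y ∈ filt F x n := by
    induction n with
    | zero => exact H.filt_zero hk hs y
    | succ n ih =>
      rw [← hu]
      exact H.mul_mem_filt hk hs u _ (hg n y ih)
  exact hne (by rw [H.eq_zero_of_mem_filt hk hs (hall _), mul_zero])

lemma mul_eq_zero_of_mem_socle (hk : 1 ≤ k) (hs : 1 ≤ s) {g : A}
    (hg : ∀ n, ∀ y ∈ filt F x n, g * y ∈ filt F x (n + 1)) {y : A} (hy : y ∈ socle A) :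
    g * y = 0 := by
  rw [socle, sSup_eq_iSup'] at hy
  induction hy using Submodule.iSup_induction' with
  | mem S y hy => exact H.mul_eq_zero_of_mem_atom hk hs hg S.2 hy
  | zero => exact mul_zero g
  | add y z _ _ hy hz => rw [mul_add, hy, hz, add_zero]

lemma top_mem_socle (hk : 1 ≤ k) (hs : 1 ≤ s) (t : ZMod 3) : word x t (3 * k) ∈ socle A := by
  set z := word x t (3 * k) with hz
  have key (u : A) : ∃ r : F, u * z = r • z := by
    refine H.gen_induction (p := fun u => ∃ r : F, u * z = r • z)
      (fun u => ?_) (fun u => ?_) ?_ (fun r => ?_) ?_ ?_ u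
    · rcases H.eps_mul_word t u (3 * k) with h | h
      · exact ⟨1, by rw [hz, h, one_smul]⟩
      · exact ⟨0, by rw [hz, h, zero_smul]⟩
    · exact ⟨0, by rw [hz, H.arr_mul_top hk hs, zero_smul]⟩
    · exact ⟨0, by rw [hz, H.h_mul_word t (by omega), zero_smul]⟩
    · exact ⟨r, by rw [Algebra.smul_def]⟩
    · rintro u v ⟨p, hp⟩ ⟨q, hq⟩
      exact ⟨p + q, by rw [add_mul, hp, hq, add_smul]⟩
    · rintro u v ⟨p, hp⟩ ⟨q, hq⟩
      exact ⟨q * p, by rw [mul_assoc, hq, mul_smul_comm, hp, smul_smul]⟩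
  by_cases h0 : z = 0
  · rw [h0]; exact zero_mem _
  refine (le_sSup (a := Submodule.span A {z}) ?_) (Submodule.mem_span_singleton_self z)
  refine ⟨fun h => h0 (Submodule.span_singleton_eq_bot.mp h), fun T hT => ?_⟩
  by_contra hne
  obtain ⟨y, hyT, hy0⟩ := Submodule.exists_mem_ne_zero_of_ne_bot hne
  obtain ⟨u, rfl⟩ := Submodule.mem_span_singleton.mp (hT.le hyT)
  obtain ⟨r, hr⟩ := key u
  rw [smul_eq_mul, hr] at hyT hy0
  have hr0 : r ≠ 0 := by rintro rfl; simp at hy0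
  refine hT.not_ge ?_
  rw [Submodule.span_singleton_le_iff_mem]
  have := T.smul_mem (algebraMap F A r⁻¹) hyT
  rwa [smul_eq_mul, ← Algebra.smul_def, smul_smul, inv_mul_cancel₀ hr0, one_smul] at this

lemma word_notMem_socle (hk : 1 ≤ k) (hs : 1 ≤ s) (t : ZMod 3) (h0 : word x t (3 * k) ≠ 0)
    {m : ℕ} (hm : m < 3 * k) : word x t m ∉ socle A := by
  intro h
  have h1 := H.mul_eq_zero_of_mem_socle hk hs
    (fun n y hy => H.arr_mul_mem_filt hk hs (t - m) hy) h
  rw [← word_succ] at h1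
  obtain ⟨i, hi⟩ := Nat.exists_eq_add_of_lt hm
  apply h0
  rw [hi, add_right_comm, ← H.word_mul, h1, mul_zero]

lemma pow_notMem_socle (hk : 1 ≤ k) (hs : 1 ≤ s) (h0 : x .h ^ s ≠ 0)
    {j : ℕ} (hj : j < s) : x .h ^ j ∉ socle A := by
  intro h
  have h1 := H.mul_eq_zero_of_mem_socle hk hs (fun n y hy => H.h_mul_mem_filt hy) h
  rw [← pow_succ'] at h1
  obtain ⟨i, hi⟩ := Nat.exists_eq_add_of_lt hj
  apply h0
  rw [hi, add_right_comm, pow_add, h1, zero_mul]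

end IsDihedral

/-- The sum of the three rotations of `(αβγ) ^ i`. -/
def rot (x : Gen → A) (i : ℕ) : A := word x 2 (3 * i) + word x 0 (3 * i) + word x 1 (3 * i)

/-- The values on the standard basis paths of the linear form that detects the socle. -/
structure IsSocleForm (k s : ℕ) (x : Gen → A) (ψ : A →ₗ[F] F) : Prop where
  word_of_lt : ∀ t m, m < 3 * k → ψ (word x t m) = 0
  word_top : ∀ t, ψ (word x t (3 * k)) = 1
  pow_of_lt : ∀ j, 1 ≤ j → j < s → ψ (x .h ^ j) = 0

namespace IsDihedral

variable {x : Gen → A} (H : IsDihedral k s c x)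
include H

lemma eps_mul_word_three (t u : ZMod 3) (i : ℕ) :
    eps x u * word x t (3 * i) = word x t (3 * i) * eps x u := by
  have h1 : eps x t * word x t (3 * i) = word x t (3 * i) := by
    simpa only [cast_three_mul, sub_zero] using H.eps_word t (3 * i)
  have h2 : word x t (3 * i) * eps x t = word x t (3 * i) := by
    simpa using H.word_mul' (t := t) (m := 0) (by simp) (3 * i)
  rcases H.eps_mul_eps t u with h | h
  · nth_rw 1 [← h1]
    nth_rw 2 [← h2]
    rw [← mul_assoc, h, mul_assoc, ← H.eps_comm, h, h1, h2]
  · nth_rw 1 [← h1]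
    nth_rw 2 [← h2]
    rw [← mul_assoc, h, mul_assoc, ← H.eps_comm, h, mul_zero, zero_mul]

/-- An element is central as soon as it commutes with the generators. -/
lemma commute_of_gens {z : A} (he : ∀ t, z * eps x t = eps x t * z)
    (ha : ∀ t, z * arr x t = arr x t * z) (hh : z * x .h = x .h * z) (u : A) : z * u = u * z :=
  H.gen_induction (p := fun u => z * u = u * z) he ha hh
    (fun r => (Algebra.commutes r z).symm)
    (fun u v hu hv => by rw [mul_add, add_mul, hu, hv])
    (fun u v hu hv => by rw [← mul_assoc, hu, mul_assoc, hv, mul_assoc]) u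

lemma pow_commute {j : ℕ} (hj : 1 ≤ j) (u : A) : x .h ^ j * u = u * x .h ^ j :=
  H.commute_of_gens (fun t => (H.eps_mul_pow t hj).1.symm)
    (fun t => by rw [H.pow_mul_arr t hj, H.arr_mul_pow t hj])
    (by rw [← pow_succ, ← pow_succ']) u

lemma top_commute (hk : 1 ≤ k) (hs : 1 ≤ s) (t : ZMod 3) (u : A) :
    word x t (3 * k) * u = u * word x t (3 * k) :=
  H.commute_of_gens (fun u => (H.eps_mul_word_three t u k).symm)
    (fun u => by
      have e : arr x u = word x u 1 := by simp [word_succ, H.arr_eps]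
      rw [H.arr_mul_top hk hs, e, H.top_mul_word hk hs _ _ le_rfl])
    (by rw [H.word_mul_h t (by omega), H.h_mul_word t (by omega)]) u

lemma rot_commute (hk : 1 ≤ k) (hs : 1 ≤ s) {i : ℕ} (hi : 1 ≤ i) (u : A) :
    rot x i * u = u * rot x i := by
  refine H.commute_of_gens (fun u => ?_) (fun u => ?_) ?_ u
  · simp only [rot, add_mul, mul_add, H.eps_mul_word_three]
  · have h1 : ¬ (3 * i = 1) := by omega
    simp only [rot, add_mul, mul_add, H.arr_mul_word hk hs _ _ (show 1 ≤ 3 * i by omega),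
      H.word_mul_arr hk hs _ _ (show 1 ≤ 3 * i by omega), cast_three_mul, sub_zero, h1, and_false,
      if_false]
    rcases zmod3_cases u with rfl | rfl | rfl <;> simp (decide := true)
  · simp only [rot, add_mul, mul_add, H.word_mul_h _ (show 1 ≤ 3 * i by omega),
      H.h_mul_word _ (show 1 ≤ 3 * i by omega)]

lemma rot_mul_word (hk : 1 ≤ k) (hs : 1 ≤ s) (t : ZMod 3) {i m : ℕ} (hi : 1 ≤ i) (hm : 1 ≤ m) :
    rot x i * word x t m = word x t (m + 3 * i) := by
  have h1 : ¬ (3 * i = 1) := by omega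
  have key (u : ZMod 3) : word x u (3 * i) * word x t m =
      if u = t - m then word x t (m + 3 * i) else 0 := by
    split_ifs with h
    · exact H.word_mul' h _
    · rw [H.word_mul_of_ne' hk hs hm (by omega) h, if_neg (by tauto)]
  simp only [rot, add_mul, key]
  rcases zmod3_cases (t - m) with h | h | h <;> rw [h] <;> simp (decide := true)

section Form

variable {ψ : A →ₗ[F] F} (P : IsSocleForm k s x ψ)
include P

lemma map_word (hk : 1 ≤ k) (hs : 1 ≤ s) (t : ZMod 3) (m : ℕ) :
    ψ (word x t m) = if m = 3 * k then 1 else 0 := by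
  rcases lt_trichotomy m (3 * k) with h | rfl | h
  · rw [P.word_of_lt t m h, if_neg h.ne]
  · rw [P.word_top, if_pos rfl]
  · rw [H.word_eq_zero hk hs t h, map_zero, if_neg h.ne']

lemma map_pow (hk : 1 ≤ k) {j : ℕ} (hj : 1 ≤ j) :
    ψ (x .h ^ j) = if j = s then 1 else 0 := by
  rcases lt_trichotomy j s with h | rfl | h
  · rw [P.pow_of_lt j hj h, if_neg h.ne]
  · rw [← H.word_one_top hk, P.word_top, if_pos rfl]
  · rw [H.pow_eq_zero_of_lt hk h, map_zero, if_neg h.ne']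

lemma map_eps_mul_word (t u : ZMod 3) {m : ℕ} (hm : m < 3 * k) :
    ψ (eps x u * word x t m) = 0 := by
  rcases H.eps_mul_word t u m with h | h <;> rw [h]
  · exact P.word_of_lt t m hm
  · exact map_zero ψ

lemma map_word_mul_eps (t u : ZMod 3) {m : ℕ} (hm : m < 3 * k) :
    ψ (word x t m * eps x u) = 0 := by
  rcases H.word_mul_eps t u m with h | h <;> rw [h]
  · exact P.word_of_lt t m hm
  · exact map_zero ψ

lemma map_pow_mul_eps (u : ZMod 3) {j : ℕ} (h1 : 1 ≤ j) (hj : j < s) :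
    ψ (x .h ^ j * eps x u) = 0 := by
  obtain ⟨h, h' | h'⟩ := H.eps_mul_pow u h1 <;> rw [← h, h']
  · exact P.pow_of_lt j h1 hj
  · exact map_zero ψ

lemma map_word_mul_word (hk : 1 ≤ k) (hs : 1 ≤ s) (t u : ZMod 3) {m n : ℕ} (hm : 1 ≤ m)
    (hn : 1 ≤ n) : ψ (word x u n * word x t m) =
      if u = t - m then if m + n = 3 * k then 1 else 0
      else if u = 0 ∧ t = 0 ∧ n = 1 ∧ m = 1 then c else 0 := by
  split_ifs with h1 h2 h3
  · rw [H.word_mul' h1, H.map_word P hk hs, if_pos h2]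
  · rw [H.word_mul' h1, H.map_word P hk hs, if_neg h2]
  · rw [H.word_mul_of_ne' hk hs hm hn h1, if_pos h3, map_smul, P.word_top, smul_eq_mul, mul_one]
  · rw [H.word_mul_of_ne' hk hs hm hn h1, if_neg h3, map_zero]

lemma map_mul_comm (hk : 1 ≤ k) (hs : 1 ≤ s) (u v : A) : ψ (u * v) = ψ (v * u) := by
  have gen (g : A) (hw : ∀ t m, ψ (g * word x t m) = ψ (word x t m * g))
      (hp : ∀ j, 1 ≤ j → ψ (g * x .h ^ j) = ψ (x .h ^ j * g)) (v : A) :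
      ψ (g * v) = ψ (v * g) := by
    refine H.path_induction hk hs (p := fun v => ψ (g * v) = ψ (v * g)) (fun t m _ => hw t m)
      (fun j hj _ => hp j hj) (by simp) (fun u v hu hv => ?_) (fun r u hu => ?_) v
    · rw [mul_add, add_mul, map_add, map_add, hu, hv]
    · rw [mul_smul_comm, smul_mul_assoc, map_smul, map_smul, hu]
  revert v
  refine H.gen_induction (p := fun u => ∀ v, ψ (u * v) = ψ (v * u)) (fun u => gen _ ?_ ?_)
    (fun u => gen _ ?_ ?_) (gen _ ?_ ?_) (fun r v => ?_) (fun u u' hu hu' v => ?_)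
    (fun u u' hu hu' v => ?_) u
  · intro t m
    rcases lt_trichotomy m (3 * k) with h | rfl | h
    · rw [H.map_eps_mul_word P t u h, H.map_word_mul_eps P t u h]
    · rw [H.eps_mul_word_three]
    · rw [H.word_eq_zero hk hs t h, zero_mul, mul_zero]
  · intro j hj
    rw [H.pow_commute hj]
  · intro t m
    rcases Nat.eq_zero_or_pos m with rfl | hm
    · have h1 : ψ (arr x u) = 0 := by
        have := P.word_of_lt u 1 (by omega)
        simpa [word_succ, H.arr_eps] using this
      rw [word_zero]
      rcases H.arr_mul_eps u t with h | h <;> rcases H.eps_mul_arr u t with h' | h' <;>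
        simp [h, h', h1]
    · have e : arr x u = word x u 1 := by simp [word_succ, H.arr_eps]
      rw [e, H.map_word_mul_word P hk hs _ _ hm le_rfl, H.map_word_mul_word P hk hs _ _ le_rfl hm]
      by_cases h3 : m + 1 = 3 * k
      · have hc := cast_three_mul k
        rw [← h3] at hc
        push_cast at hc
        have hiff : u = t - m ↔ t = u - (1 : ℕ) := by
          rw [Nat.cast_one]
          constructor
          · intro h; linear_combination -h + hc
          · intro h; linear_combination -h + hc
        simp only [hiff, h3, add_comm 1 m]
        grind
      · have h3' : ¬ (1 + m = 3 * k) := by omega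
        by_cases hx : u = 0 ∧ t = 0 ∧ m = 1
        · obtain ⟨rfl, rfl, rfl⟩ := hx
          rfl
        · have hx' : ¬ (t = 0 ∧ u = 0 ∧ m = 1) := by tauto
          simp only [h3, h3', hx, hx', true_and, and_true, if_false, ite_self]
  · intro j hj
    rw [H.pow_commute hj]
  · intro t m
    have := H.pow_commute (j := 1) le_rfl (word x t m)
    rw [pow_one] at this
    rw [this]
  · intro j hj
    rw [← pow_succ, ← pow_succ']
  · rw [Algebra.commutes]
  · rw [add_mul, mul_add, map_add, map_add, hu, hu']
  · rw [mul_assoc, hu, mul_assoc, hu', mul_assoc]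

lemma map_mul_eq_zero_of_mem_Kspan (hk : 1 ≤ k) (hs : 1 ≤ s) {z : A}
    (hz : ∀ u, z * u = u * z) {v : A} (hv : v ∈ Kspan F A) : ψ (z * v) = 0 := by
  induction hv using Submodule.span_induction with
  | mem v hv =>
    obtain ⟨u, w, rfl⟩ := hv
    rw [mul_sub, map_sub, ← mul_assoc, H.map_mul_comm P hk hs (z * u) w, ← mul_assoc, ← hz w,
      ← mul_assoc, sub_self]
  | zero => simp
  | add u v _ _ hu hv => rw [mul_add, map_add, hu, hv, add_zero]
  | smul r u _ hu => rw [mul_smul_comm, map_smul, hu, smul_zero]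

/-- If `ψ (y * b) ^ 2 = ψ (z * b ^ 2)` on standard basis paths `b`, for a central `z`, then `y` is
orthogonal to all elements whose square lies in the commutator space. -/
lemma map_mul_eq_zero_of_sq (hk : 1 ≤ k) (hs : 1 ≤ s) [CharP F 2] {y z : A}
    (hz : ∀ u, z * u = u * z)
    (he : ∀ t, ψ (y * eps x t) ^ 2 = ψ (z * eps x t))
    (hw : ∀ t m, 1 ≤ m → m ≤ 3 * k →
      ψ (y * word x t m) ^ 2 = ψ (z * (word x t m * word x t m)))
    (hp : ∀ j, 1 ≤ j → j ≤ s → ψ (y * x .h ^ j) ^ 2 = ψ (z * x .h ^ (j + j)))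
    {v : A} (hv : v ^ 2 ∈ Kspan F A) : ψ (y * v) = 0 := by
  have key : ψ (y * v) ^ 2 = ψ (z * (v * v)) := by
    refine H.path_induction hk hs (p := fun v => ψ (y * v) ^ 2 = ψ (z * (v * v)))
      (fun t m hm => ?_) (fun j h1 hj => ?_) (by simp) (fun u v hu hv => ?_) (fun r u hu => ?_) v
    · rcases Nat.eq_zero_or_pos m with rfl | h
      · rw [word_zero, H.eps_mul_self, he]
      · exact hw t m h hm
    · rw [← pow_add, hp j h1 hj]
    · have hcomm : ψ (z * (u * v)) = ψ (z * (v * u)) := by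
        rw [← mul_assoc, H.map_mul_comm P hk hs, ← mul_assoc, ← hz, mul_assoc]
      rw [mul_add, map_add, CharTwo.add_sq, hu, hv, add_mul, mul_add, mul_add, mul_add, mul_add,
        mul_add, map_add, map_add, map_add, hcomm]
      linear_combination -(CharTwo.add_self_eq_zero (ψ (z * (v * u))))
    · rw [mul_smul_comm, map_smul, smul_mul_smul_comm, mul_smul_comm, map_smul, smul_eq_mul,
        smul_eq_mul, mul_pow, hu, pow_two]
  rw [← pow_two v, H.map_mul_eq_zero_of_mem_Kspan P hk hs hz hv] at key
  exact pow_eq_zero_iff (two_ne_zero) |>.mp key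

end Form

end IsDihedral

/-- The explicit basis of the generalized Reynolds ideal. -/
def reynoldsBasis (k s : ℕ) (c : F) (x : Gen → A) : Set A :=
  {x .h ^ (s / 2) + c • word x 2 (3 * k - 1)} ∪ rot x '' Set.Icc ((k + 1) / 2) (k - 1)
    ∪ {word x 2 (3 * k)} ∪ (fun j => x .h ^ j) '' Set.Icc (s / 2 + 1) s

lemma cast_three_mul_sub_one {k : ℕ} (hk : 1 ≤ k) : ((3 * k - 1 : ℕ) : ZMod 3) = -1 := by
  rw [Nat.cast_sub (by omega), cast_three_mul, Nat.cast_one, zero_sub]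

lemma cast_zmod3_eq_zero {m : ℕ} : (m : ZMod 3) = 0 ↔ ∃ i, m = 3 * i :=
  ZMod.natCast_eq_zero_iff m 3

namespace IsDihedral

variable {x : Gen → A} (H : IsDihedral k s c x)
include H

lemma word_mul_self (hk : 1 ≤ k) (hs : 1 ≤ s) (t : ZMod 3) {m : ℕ} (hm : 1 ≤ m) :
    word x t m * word x t m = if (m : ZMod 3) = 0 then word x t (m + m) else
      if t = 0 ∧ m = 1 then c • word x 2 (3 * k) else 0 := by
  split_ifs with h1 h2
  · exact H.word_mul' (by rw [h1, sub_zero]) m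
  all_goals
    rw [H.word_mul_of_ne' hk hs hm hm (by intro h; apply h1; linear_combination h)]
    simp only [← and_assoc, and_self] at *
    simp [h2]

section Form

variable {ψ : A →ₗ[F] F} (P : IsSocleForm k s x ψ)
include P

lemma map_top_mul_eps (t u : ZMod 3) :
    ψ (word x t (3 * k) * eps x u) = 0 ∨ ψ (word x t (3 * k) * eps x u) = 1 := by
  rcases H.word_mul_eps t u (3 * k) with h | h <;> rw [h]
  · exact Or.inr (P.word_top t)
  · exact Or.inl (map_zero ψ)

lemma map_rot_mul_eps {i : ℕ} (hi : i < k) (u : ZMod 3) : ψ (rot x i * eps x u) = 0 := by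
  simp only [rot, add_mul, map_add, H.map_word_mul_eps P _ _ (show 3 * i < 3 * k by omega),
    add_zero]

/-- The claimed basis elements are orthogonal to `T₁`. -/
theorem map_mul_eq_zero [CharP F 2] (hk : 1 ≤ k) (hkodd : Odd k) (hs : 2 ≤ s) (hsev : Even s)
    (hc : c ^ 2 = c) {y v : A} (hy : y ∈ reynoldsBasis k s c x) (hv : v ^ 2 ∈ Kspan F A) :
    ψ (y * v) = 0 := by
  have hs1 : 1 ≤ s := by omega
  obtain ⟨d, hd⟩ := hsev
  obtain ⟨l, hl⟩ := hkodd
  rcases hy with ((hy | ⟨i, hi, rfl⟩) | hy) | ⟨j, hj, rfl⟩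
  · rw [Set.mem_singleton_iff] at hy
    subst hy
    refine H.map_mul_eq_zero_of_sq P hk hs1 (z := 1) (by simp) (fun t => ?_) (fun t m hm hm' => ?_)
      (fun j hj hj' => ?_) hv
    · have h1 : ψ (eps x t) = 0 := P.word_of_lt t 0 (by omega)
      rw [add_mul, map_add, H.map_pow_mul_eps P t (by omega) (by omega), smul_mul_assoc, map_smul,
        H.map_word_mul_eps P _ _ (by omega), one_mul, h1]
      simp
    · rw [add_mul, map_add, H.pow_mul_word t (by omega) hm, map_zero, zero_add, smul_mul_assoc,
        map_smul, H.map_word_mul_word P hk hs1 t 2 hm (by omega), one_mul,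
        H.word_mul_self hk hs1 t hm]
      by_cases h1 : t = 0 ∧ m = 1
      · obtain ⟨rfl, rfl⟩ := h1
        rw [if_pos (by decide), if_pos (by omega), if_neg (by decide), if_pos (by simp), map_smul,
          P.word_top, smul_eq_mul, mul_one, hc]
      · have h2 : ψ (if (m : ZMod 3) = 0 then word x t (m + m) else
            if t = 0 ∧ m = 1 then c • word x 2 (3 * k) else 0) = 0 := by
          rw [if_neg h1]
          split_ifs
          · rw [H.map_word P hk hs1, if_neg (by omega)]
          · exact map_zero ψ
        rw [h2]
        by_cases h3 : m = 1
        · rw [if_neg, if_neg (fun h => absurd h.1 (by decide)), smul_zero, zero_pow two_ne_zero]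
          subst h3
          intro h
          apply h1
          have ht : t = 2 + 1 := by
            rw [h]
            push_cast; ring
          exact ⟨ht, rfl⟩
        · have h4 : ¬ (m + (3 * k - 1) = 3 * k) := by omega
          simp [h3, h4]
    · rw [add_mul, smul_mul_assoc, H.word_mul_pow _ hj (by omega), smul_zero, add_zero, ← pow_add,
        one_mul, H.map_pow P hk (by omega), H.map_pow P hk (by omega)]
      have : s / 2 + j = s ↔ j + j = s := by omega
      simp only [this]
      split_ifs <;> simp
  · obtain ⟨hi1, hi2⟩ := hi
    refine H.map_mul_eq_zero_of_sq P hk hs1 (z := rot x (2 * i - k))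
      (H.rot_commute hk hs1 (by omega)) (fun t => ?_) (fun t m hm hm' => ?_)
      (fun j hj hj' => ?_) hv
    · rw [H.map_rot_mul_eps P (by omega), H.map_rot_mul_eps P (by omega), zero_pow two_ne_zero]
    · rw [H.rot_mul_word hk hs1 t (by omega) hm, H.map_word P hk hs1, H.word_mul_self hk hs1 t hm]
      split_ifs with h1 h2 h3 h4
      · rw [H.rot_mul_word hk hs1 t (by omega) (by omega), H.map_word P hk hs1, if_pos (by omega),
          one_pow]
      · exfalso; omega
      · exfalso
        exact h2 (cast_zmod3_eq_zero.mpr ⟨k - i, by omega⟩)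
      · rw [H.rot_mul_word hk hs1 t (by omega) (by omega), H.map_word P hk hs1, if_neg (by omega),
          zero_pow two_ne_zero]
      · rw [mul_smul_comm, H.rot_mul_word hk hs1 2 (by omega) (by omega),
          H.word_eq_zero hk hs1 _ (by omega)]
        simp
      · simp
    · simp only [rot, add_mul, H.word_mul_pow _ hj (show 1 ≤ 3 * i by omega),
        H.word_mul_pow _ (show 1 ≤ j + j by omega) (show 1 ≤ 3 * (2 * i - k) by omega)]
      simp
  · rw [Set.mem_singleton_iff] at hy
    subst hy
    refine H.map_mul_eq_zero_of_sq P hk hs1 (z := word x 2 (3 * k))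
      (H.top_commute hk hs1 2) (fun t => ?_) (fun t m hm hm' => ?_)
      (fun j hj hj' => ?_) hv
    · rcases H.map_top_mul_eps P 2 t with h | h <;> simp [h]
    · rw [H.top_mul_word hk hs1 _ _ hm, ← mul_assoc, H.top_mul_word hk hs1 _ _ hm]
      simp
    · rw [H.word_mul_pow _ hj (by omega), H.word_mul_pow _ (by omega) (by omega)]
      simp
  · obtain ⟨hj1, hj2⟩ := hj
    dsimp only
    refine H.map_mul_eq_zero_of_sq P hk hs1 (z := x .h ^ (2 * j - s))
      (H.pow_commute (by omega)) (fun t => ?_) (fun t m hm hm' => ?_)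
      (fun i hi hi' => ?_) hv
    · rcases hj2.eq_or_lt with rfl | hlt
      · rw [show 2 * j - j = j by omega, ← H.word_one_top hk]
        rcases H.map_top_mul_eps P 1 t with h | h <;> simp [h]
      · rw [H.map_pow_mul_eps P t (by omega) hlt, H.map_pow_mul_eps P t (by omega) (by omega)]
        simp
    · rw [H.pow_mul_word _ (by omega) hm, ← mul_assoc, H.pow_mul_word _ (by omega) hm]
      simp
    · rw [← pow_add, ← pow_add, H.map_pow P hk (by omega), H.map_pow P hk (by omega)]
      have : 2 * j - s + (i + i) = s ↔ j + i = s := by omega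
      simp only [this]
      split_ifs <;> simp

end Form

end IsDihedral

lemma linearIndependent_of_dual {B : Type} [AddCommGroup B] [Module F B] {S : Set B}
    (h : ∀ p ∈ S, ∃ f : B →ₗ[F] F, f p ≠ 0 ∧ ∀ q ∈ S, q ≠ p → f q = 0) :
    LinearIndependent F (fun p : S => (p : B)) := by
  rw [linearIndependent_iff']
  intro T g hg p hp
  obtain ⟨f, hf, hf'⟩ := h p p.2
  have h1 := congrArg f hg
  rw [map_sum, map_zero, Finset.sum_eq_single p] at h1
  · rw [map_smul, smul_eq_mul] at h1
    exact (mul_eq_zero.mp h1).resolve_right hf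
  · intro q _ hq
    rw [map_smul, hf' q q.2 (fun h => hq (Subtype.ext h)), smul_zero]
  · exact fun h => absurd hp h

namespace IsDihedral

variable {x : Gen → A} (H : IsDihedral k s c x)
include H

lemma word_sub_word_pred_mem_Kspan (t : ZMod 3) {i : ℕ} (hi : 1 ≤ i) :
    word x t (3 * i) - word x (t - 1) (3 * i) ∈ Kspan F A := by
  obtain ⟨n, hn⟩ : ∃ n, 3 * i = n + 1 := ⟨3 * i - 1, by omega⟩
  have hc := cast_three_mul i
  rw [hn] at hc ⊢
  push_cast at hc
  refine Submodule.subset_span ⟨word x (t - 1) n, arr x t, ?_⟩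
  rw [H.word_succ' t, word_succ x (t - 1), show t - 1 - (n : ZMod 3) = t by linear_combination -hc]

lemma word_sub_word_mem_Kspan (t u : ZMod 3) {i : ℕ} (hi : 1 ≤ i) :
    word x t (3 * i) - word x u (3 * i) ∈ Kspan F A := by
  have key (t : ZMod 3) : word x t (3 * i) - word x 0 (3 * i) ∈ Kspan F A := by
    have h1 := H.word_sub_word_pred_mem_Kspan 1 hi
    have h2 := H.word_sub_word_pred_mem_Kspan 2 hi
    rcases zmod3_cases t with rfl | rfl | rfl
    · rw [sub_self]; exact zero_mem _
    · exact h1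
    · have := add_mem h2 h1
      rwa [show (2 - 1 : ZMod 3) = 1 by decide, sub_self, sub_add_sub_cancel] at this
  simpa using sub_mem (key t) (key u)

lemma sq_word_mem_Kspan (hk : 1 ≤ k) (hs : 1 ≤ s) {t : ZMod 3} {m : ℕ} (hm : 1 ≤ m)
    (h1 : (m : ZMod 3) = 0 → 3 * k < 2 * m) (h2 : ¬ (t = 0 ∧ m = 1)) :
    word x t m ^ 2 ∈ Kspan F A := by
  rw [pow_two, H.word_mul_self hk hs t hm, if_neg h2]
  split_ifs with h
  · rw [H.word_eq_zero hk hs t (by have := h1 h; omega)]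
    exact zero_mem _
  · exact zero_mem _

lemma sq_pow_mem_Kspan (hk : 1 ≤ k) {j : ℕ} (hj : s < 2 * j) :
    (x .h ^ j) ^ 2 ∈ Kspan F A := by
  rw [← pow_mul, H.pow_eq_zero_of_lt hk (by omega)]
  exact zero_mem _

lemma sq_sub_mem_Kspan [CharP F 2] (hk : 1 ≤ k) (hs : 1 ≤ s) (t u : ZMod 3) {i : ℕ}
    (hi : 1 ≤ i) : (word x t (3 * i) - word x u (3 * i)) ^ 2 ∈ Kspan F A := by
  rcases eq_or_ne t u with rfl | htu
  · simp
  have h3 : ¬ (3 * i = 1) := by omega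
  have key (t u : ZMod 3) (h : t ≠ u) : word x t (3 * i) * word x u (3 * i) = 0 := by
    rw [H.word_mul_of_ne' hk hs (by omega) (by omega), if_neg (by tauto)]
    rwa [cast_three_mul, sub_zero]
  have e : (word x t (3 * i) - word x u (3 * i)) ^ 2 =
      word x t (3 * (2 * i)) - word x u (3 * (2 * i)) +
        (2 : F) • word x u (3 * (2 * i)) := by
    rw [pow_two, sub_mul, mul_sub, mul_sub, key t u htu, key u t htu.symm,
      H.word_mul_self hk hs t (by omega), H.word_mul_self hk hs u (by omega),
      if_pos (cast_three_mul i), if_pos (cast_three_mul i),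
      show 3 * i + 3 * i = 3 * (2 * i) by ring, ofNat_smul_eq_nsmul, two_nsmul]
    abel
  rw [e, show (2 : F) = 0 from CharTwo.two_eq_zero, zero_smul, add_zero]
  exact H.word_sub_word_mem_Kspan t u (by omega)

lemma sq_arrow_add_mem_Kspan [CharP F 2] (hk : 1 ≤ k) (hs : 2 ≤ s) (hsev : Even s)
    (hc : c ^ 2 = c) :
    (word x 0 1 + c • x .h ^ (s / 2)) ^ 2 ∈ Kspan F A := by
  obtain ⟨d, hd⟩ := hsev
  have e : (word x 0 1 + c • x .h ^ (s / 2)) ^ 2 =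
      c • ((word x 2 (3 * k) - word x 1 (3 * k)) + (2 : F) • word x 1 (3 * k)) := by
    rw [pow_two, add_mul, mul_add, mul_add, mul_smul_comm, smul_mul_assoc, smul_mul_smul_comm,
      H.pow_mul_word 0 (by omega) le_rfl, H.word_mul_pow 0 (by omega) le_rfl, ← pow_two c, hc,
      ← pow_add, show s / 2 + s / 2 = s by omega, ← H.word_one_top hk,
      H.word_mul_self hk (by omega) 0 le_rfl, if_neg (by decide), if_pos (by simp),
      ofNat_smul_eq_nsmul, two_nsmul, smul_zero]
    simp only [smul_add, smul_sub]
    abel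
  rw [e, show (2 : F) = 0 from CharTwo.two_eq_zero, zero_smul, add_zero]
  exact Submodule.smul_mem _ _ (H.word_sub_word_mem_Kspan 2 1 hk)

lemma eps_mul_word_three_eq (t u : ZMod 3) (i : ℕ) :
    eps x u * word x t (3 * i) = if u = 1 ↔ t = 1 then word x t (3 * i) else 0 := by
  have h1 : eps x t * word x t (3 * i) = word x t (3 * i) := by
    simpa only [cast_three_mul, sub_zero] using H.eps_word t (3 * i)
  rw [← h1, ← mul_assoc]
  rcases zmod3_cases t with rfl | rfl | rfl <;> rcases zmod3_cases u with rfl | rfl | rfl <;>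
    simp (decide := true) [H.idem1, H.idem2, H.orth12, H.orth21]

section Form

variable {ψ : A →ₗ[F] F} (P : IsSocleForm k s x ψ)
include P

lemma map_word_mul_dual (hk : 1 ≤ k) (hs : 1 ≤ s) (t u : ZMod 3) {m n : ℕ} (hm : 1 ≤ m)
    (hm' : m < 3 * k) (hn : 1 ≤ n) :
    ψ (word x u n * word x (t - m) (3 * k - m)) = (if u = t ∧ n = m then 1 else 0) +
      if u = 0 ∧ n = 1 ∧ t = 2 ∧ m = 3 * k - 1 then c else 0 := by
  have h1 : t - m - ((3 * k - m : ℕ) : ZMod 3) = t := by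
    rw [Nat.cast_sub hm'.le, cast_three_mul]; ring
  have h2 : 3 * k - m + n = 3 * k ↔ n = m := by omega
  rw [H.map_word_mul_word P hk hs _ _ (by omega) hn, h1]
  simp only [h2]
  have h3 : u ≠ t → ((u = 0 ∧ t - m = 0 ∧ n = 1 ∧ 3 * k - m = 1) ↔
      (u = 0 ∧ n = 1 ∧ t = 2 ∧ m = 3 * k - 1)) := by
    intro _
    constructor
    · rintro ⟨a1, a2, a3, a4⟩
      obtain rfl : m = 3 * k - 1 := by omega
      rw [cast_three_mul_sub_one hk] at a2
      refine ⟨a1, a3, ?_, rfl⟩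
      rw [show (2 : ZMod 3) = -1 by decide]
      linear_combination a2
    · rintro ⟨a1, a2, rfl, rfl⟩
      rw [cast_three_mul_sub_one hk]
      exact ⟨a1, by decide, a2, by omega⟩
  by_cases h : u = t
  · have h4 : ¬ (u = 0 ∧ n = 1 ∧ t = 2 ∧ m = 3 * k - 1) := by
      rintro ⟨h5, -, h6, -⟩
      rw [h, h6] at h5
      exact absurd h5 (by decide)
    rw [if_pos h, if_neg h4, add_zero]
    simp [h]
  · simp only [h, h3 h, if_false, false_and, zero_add]

lemma sum_map_word_smul (hk : 1 ≤ k) (hs : 1 ≤ s) (u : ZMod 3) {n : ℕ} (hn : 1 ≤ n)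
    (hn' : n < 3 * k) :
    ∑ m ∈ Finset.Icc 1 (3 * k - 1), ∑ t : ZMod 3,
      ψ (word x u n * word x (t - m) (3 * k - m)) • word x t m =
    word x u n + (if u = 0 ∧ n = 1 then c else 0) • word x 2 (3 * k - 1) := by
  have e : ∀ m ∈ Finset.Icc 1 (3 * k - 1), ∑ t : ZMod 3,
      ψ (word x u n * word x (t - m) (3 * k - m)) • word x t m =
      (if n = m then word x u m else 0) +
        if m = 3 * k - 1 then (if u = 0 ∧ n = 1 then c else 0) • word x 2 m else 0 := by
    intro m hm
    rw [Finset.mem_Icc] at hm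
    rw [Finset.sum_congr rfl fun t _ => by
      rw [H.map_word_mul_dual P hk hs t u hm.1 (by omega) hn, add_smul], Finset.sum_add_distrib]
    congr 1
    · rw [Finset.sum_eq_single u (fun t _ ht => by simp [ht.symm]) (by simp)]
      simp
    · rw [Finset.sum_eq_single 2 (fun t _ ht => by simp [ht]) (by simp)]
      split_ifs <;> simp_all
  rw [Finset.sum_congr rfl e, Finset.sum_add_distrib, Finset.sum_ite_eq, Finset.sum_ite_eq',
    if_pos (Finset.mem_Icc.mpr ⟨hn, by omega⟩), if_pos (Finset.mem_Icc.mpr ⟨by omega, le_rfl⟩)]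

/-- The expansion of an element in the standard basis, in terms of the form `ψ`. -/
theorem expansion (hk : 1 ≤ k) (hs : 2 ≤ s) (y : A) :
    y = ψ (y * word x 2 (3 * k)) • eps x 0 + ψ (y * word x 1 (3 * k)) • eps x 1 +
      ψ (y * eps x 0) • word x 2 (3 * k) + ψ (y * eps x 1) • word x 1 (3 * k) +
      ∑ m ∈ Finset.Icc 1 (3 * k - 1), ∑ t : ZMod 3,
        ψ (y * word x (t - m) (3 * k - m)) • word x t m +
      ∑ j ∈ Finset.Icc 1 (s - 1), ψ (y * x .h ^ (s - j)) • x .h ^ j -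
      (c * ψ (y * word x 2 (3 * k - 1))) • word x 2 (3 * k - 1) := by
  have hs1 : 1 ≤ s := by omega
  have hsum0 (y : A) (h : ∀ t m, 1 ≤ m → m < 3 * k → ψ (y * word x t m) = 0) :
      ∑ m ∈ Finset.Icc 1 (3 * k - 1), ∑ t : ZMod 3,
        ψ (y * word x (t - m) (3 * k - m)) • word x t m = 0 := by
    refine Finset.sum_eq_zero fun m hm => Finset.sum_eq_zero fun t _ => ?_
    rw [Finset.mem_Icc] at hm
    rw [h _ _ (by omega) (by omega), zero_smul]
  have hpow0 (y : A) (h : ∀ j, 1 ≤ j → j < s → ψ (y * x .h ^ j) = 0) :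
      ∑ j ∈ Finset.Icc 1 (s - 1), ψ (y * x .h ^ (s - j)) • x .h ^ j = 0 := by
    refine Finset.sum_eq_zero fun j hj => ?_
    rw [Finset.mem_Icc] at hj
    rw [h _ (by omega) (by omega), zero_smul]
  have hepsw (u t : ZMod 3) : ψ (eps x u * eps x t) = 0 := by
    have := H.map_eps_mul_word P t u (m := 0) (by omega)
    rwa [word_zero] at this
  have heps (u : ZMod 3) (hu : u = 0 ∨ u = 1) : eps x u =
      ψ (eps x u * word x 2 (3 * k)) • eps x 0 + ψ (eps x u * word x 1 (3 * k)) • eps x 1 := by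
    rw [H.eps_mul_word_three_eq, H.eps_mul_word_three_eq]
    rcases hu with rfl | rfl <;> simp (decide := true) [P.word_top]
  have htop (u : ZMod 3) (hu : u = 2 ∨ u = 1) : word x u (3 * k) =
      ψ (word x u (3 * k) * eps x 0) • word x 2 (3 * k) +
        ψ (word x u (3 * k) * eps x 1) • word x 1 (3 * k) := by
    rw [← H.eps_mul_word_three, ← H.eps_mul_word_three, H.eps_mul_word_three_eq,
      H.eps_mul_word_three_eq]
    rcases hu with rfl | rfl <;> simp (decide := true) [P.word_top]
  induction y using H.path_induction hk hs1 with
  | hw u n hn =>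
    rcases Nat.eq_zero_or_pos n with rfl | hn0
    · obtain ⟨v, hv, hv'⟩ : ∃ v : ZMod 3, (v = 0 ∨ v = 1) ∧ eps x u = eps x v := by
        rcases zmod3_cases u with rfl | rfl | rfl
        · exact ⟨0, by simp, rfl⟩
        · exact ⟨1, by simp, rfl⟩
        · exact ⟨0, by simp, rfl⟩
      rw [word_zero, hv', hsum0 _ fun t m _ hm => H.map_eps_mul_word P t v hm,
        hpow0 _ fun j h1 hj => by rw [(H.eps_mul_pow v h1).1, H.map_pow_mul_eps P v h1 hj],
        hepsw, hepsw, H.map_eps_mul_word P 2 v (m := 3 * k - 1) (by omega)]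
      simpa using heps v hv
    · rcases hn.eq_or_lt with rfl | hlt
      · obtain ⟨v, hv, hv'⟩ : ∃ v : ZMod 3, (v = 2 ∨ v = 1) ∧
            word x u (3 * k) = word x v (3 * k) := by
          rcases zmod3_cases u with rfl | rfl | rfl
          · exact ⟨2, by simp, H.word_top hk⟩
          · exact ⟨1, by simp, rfl⟩
          · exact ⟨2, by simp, rfl⟩
        rw [hv', hsum0 _ fun t m h1 hm => by rw [H.top_mul_word hk hs1 _ _ h1, map_zero],
          hpow0 _ fun j h1 hj => by rw [H.word_mul_pow v h1 (by omega), map_zero],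
          H.top_mul_word hk hs1 _ _ (by omega), H.top_mul_word hk hs1 _ _ (by omega),
          H.top_mul_word hk hs1 _ _ (by omega)]
        simpa using htop v hv
      · have h1 : ψ (word x u n * word x 2 (3 * k - 1)) = if u = 0 ∧ n = 1 then 1 else 0 := by
          have h2 : 3 * k - 1 + n = 3 * k ↔ n = 1 := by omega
          have h3 : ¬ (u = 0 ∧ (2 : ZMod 3) = 0 ∧ n = 1 ∧ 3 * k - 1 = 1) :=
            fun h => absurd h.2.1 (by decide)
          rw [H.map_word_mul_word P hk hs1 _ _ (by omega) hn0, cast_three_mul_sub_one hk,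
            show (2 - -1 : ZMod 3) = 0 by decide, if_neg h3]
          simp only [h2, ite_and]
        rw [H.sum_map_word_smul P hk hs1 u hn0 hlt, h1,
          hpow0 _ fun j h1 hj => by rw [H.word_mul_pow u h1 hn0, map_zero],
          H.map_word_mul_eps P _ _ hlt, H.map_word_mul_eps P _ _ hlt,
          ← H.top_commute hk hs1, ← H.top_commute hk hs1, H.top_mul_word hk hs1 _ _ hn0,
          H.top_mul_word hk hs1 _ _ hn0]
        simp
  | hp i hi hi' =>
    rcases hi'.eq_or_lt with rfl | hlt
    · rw [← H.word_one_top hk, hsum0 _ fun t m h1 hm => by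
          rw [H.top_mul_word hk hs1 _ _ h1, map_zero],
        H.top_mul_word hk hs1 _ _ (by omega), H.top_mul_word hk hs1 _ _ (by omega),
        H.top_mul_word hk hs1 _ _ (by omega),
        Finset.sum_eq_zero fun j hj => by
          rw [Finset.mem_Icc] at hj
          rw [H.word_mul_pow 1 (by omega) (by omega), map_zero, zero_smul]]
      simpa using htop 1 (by simp)
    · have hsum : ∑ j ∈ Finset.Icc 1 (s - 1), ψ (x .h ^ i * x .h ^ (s - j)) • x .h ^ j =
          x .h ^ i := by
        rw [Finset.sum_eq_single i]
        · rw [← pow_add, H.map_pow P hk (by omega), if_pos (by omega), one_smul]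
        · intro j hj hji
          rw [Finset.mem_Icc] at hj
          rw [← pow_add, H.map_pow P hk (by omega), if_neg (by omega), zero_smul]
        · intro h
          exact absurd (Finset.mem_Icc.mpr ⟨hi, by omega⟩) h
      rw [hsum, hsum0 _ fun t m h1 hm => by rw [H.pow_mul_word t hi h1, map_zero],
        H.pow_mul_word 2 hi (by omega), H.pow_mul_word 1 hi (by omega),
        H.pow_mul_word 2 hi (by omega), H.map_pow_mul_eps P _ hi hlt,
        H.map_pow_mul_eps P _ hi hlt]
      simp
  | hzero => simp
  | hadd u v hu hv =>
    nth_rw 1 [hu, hv]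
    simp only [add_mul, map_add, add_smul, Finset.sum_add_distrib, mul_add]
    abel
  | hsmul r u hu =>
    nth_rw 1 [hu]
    simp only [smul_mul_assoc, map_smul, smul_add, smul_sub, Finset.smul_sum, smul_smul,
      smul_eq_mul, mul_left_comm]

end Form

end IsDihedral

namespace IsDihedral

variable {x : Gen → A} (H : IsDihedral k s c x)
include H

section Form

variable {ψ : A →ₗ[F] F} (P : IsSocleForm k s x ψ)
include P

/-- An element that is orthogonal to `T₁` is a combination of the claimed basis elements. -/
theorem mem_span_of_orthogonal [CharP F 2] (hk : 1 ≤ k) (hkodd : Odd k) (hs : 2 ≤ s)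
    (hsev : Even s) (hc : c ^ 2 = c) {y : A} (hy : ∀ v, v ^ 2 ∈ Kspan F A → ψ (y * v) = 0) :
    y ∈ Submodule.span F (reynoldsBasis k s c x) := by
  have hs1 : 1 ≤ s := by omega
  have hpar := hsev
  obtain ⟨d, hd⟩ := hpar
  obtain ⟨l, hl⟩ := hkodd
  set W := Submodule.span F (reynoldsBasis k s c x) with hW
  have hspecial : x .h ^ (s / 2) + c • word x 2 (3 * k - 1) ∈ W :=
    Submodule.subset_span (Or.inl (Or.inl (Or.inl rfl)))
  have htop : word x 2 (3 * k) ∈ W := Submodule.subset_span (Or.inl (Or.inr rfl))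
  have hrot {i : ℕ} (h1 : k < 2 * i) (h2 : i < k) : rot x i ∈ W :=
    Submodule.subset_span (Or.inl (Or.inl (Or.inr ⟨i, ⟨by omega, by omega⟩, rfl⟩)))
  have hpow {j : ℕ} (h1 : s / 2 < j) (h2 : j ≤ s) : x .h ^ j ∈ W :=
    Submodule.subset_span (Or.inr ⟨j, ⟨by omega, by omega⟩, rfl⟩)
  have hw {t : ZMod 3} {m : ℕ} (h0 : 1 ≤ m) (h1 : (m : ZMod 3) = 0 → 3 * k < 2 * m)
      (h2 : ¬ (t = 0 ∧ m = 1)) : ψ (y * word x t m) = 0 :=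
    hy _ (H.sq_word_mem_Kspan hk hs1 h0 h1 h2)
  have hcross (m : ℕ) (hm1 : 1 ≤ m) (hm : m < 3 * k - 1) :
      ∑ t : ZMod 3, ψ (y * word x (t - m) (3 * k - m)) • word x t m ∈ W := by
    by_cases h : ∃ i, m = 3 * i
    · obtain ⟨i, rfl⟩ := h
      rw [cast_three_mul, show 3 * k - 3 * i = 3 * (k - i) by omega]
      simp only [sub_zero]
      rcases lt_or_ge (2 * i) k with hik | hik
      · rw [Finset.sum_eq_zero fun t _ => by
          rw [hw (by omega) (fun _ => by omega) (by omega), zero_smul]]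
        exact zero_mem _
      · have hconst (t : ZMod 3) :
            ψ (y * word x t (3 * (k - i))) = ψ (y * word x 2 (3 * (k - i))) := by
          have := hy _ (H.sq_sub_mem_Kspan hk hs1 t 2 (i := k - i) (by omega))
          rwa [mul_sub, map_sub, sub_eq_zero] at this
        have hsum : ∑ t : ZMod 3, word x t (3 * i) = rot x i := by
          have : (Finset.univ : Finset (ZMod 3)) = {2, 0, 1} := by decide
          rw [this, Finset.sum_insert (by decide), Finset.sum_insert (by decide),
            Finset.sum_singleton, ← add_assoc, rot]
        rw [Finset.sum_congr rfl fun t _ => by rw [hconst], ← Finset.smul_sum, hsum]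
        exact W.smul_mem _ (hrot (by omega) (by omega))
    · rw [Finset.sum_eq_zero fun t _ => by
        rw [hw (by omega) (fun h0 => absurd (cast_zmod3_eq_zero.mp h0) fun ⟨i, hi⟩ =>
          h ⟨k - i, by omega⟩) (by omega), zero_smul]]
      exact zero_mem _
  have hS : ∑ m ∈ Finset.Icc 1 (3 * k - 1), ∑ t : ZMod 3,
      ψ (y * word x (t - m) (3 * k - m)) • word x t m -
        ψ (y * word x 0 1) • word x 2 (3 * k - 1) ∈ W := by
    have hlast : ∑ t : ZMod 3, ψ (y * word x (t - (3 * k - 1 : ℕ)) (3 * k - (3 * k - 1))) •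
        word x t (3 * k - 1) = ψ (y * word x 0 1) • word x 2 (3 * k - 1) := by
      rw [cast_three_mul_sub_one hk, show 3 * k - (3 * k - 1) = 1 by omega,
        Finset.sum_eq_single 2, show (2 - -1 : ZMod 3) = 0 by decide]
      · intro t _ ht
        rw [hw le_rfl (fun h => absurd h (by decide)), zero_smul]
        rintro ⟨h, -⟩
        apply ht
        rw [show (2 : ZMod 3) = -1 by decide]
        linear_combination h
      · simp
    rw [← Finset.add_sum_erase _ _ (Finset.mem_Icc.mpr ⟨by omega, le_rfl⟩ :
      3 * k - 1 ∈ Finset.Icc 1 (3 * k - 1)), hlast, add_sub_cancel_left]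
    refine sum_mem fun m hm => ?_
    rw [Finset.mem_erase, Finset.mem_Icc] at hm
    exact hcross m (by omega) (by omega)
  have hQ : ∑ j ∈ Finset.Icc 1 (s - 1), ψ (y * x .h ^ (s - j)) • x .h ^ j -
      ψ (y * x .h ^ (s / 2)) • x .h ^ (s / 2) ∈ W := by
    rw [← Finset.add_sum_erase _ _ (Finset.mem_Icc.mpr ⟨by omega, by omega⟩ :
      s / 2 ∈ Finset.Icc 1 (s - 1)), show s - s / 2 = s / 2 by omega, add_sub_cancel_left]
    refine sum_mem fun j hj => ?_
    rw [Finset.mem_erase, Finset.mem_Icc] at hj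
    rcases lt_or_gt_of_ne hj.1 with h | h
    · rw [hy _ (H.sq_pow_mem_Kspan hk (by omega)), zero_smul]
      exact zero_mem _
    · exact W.smul_mem _ (hpow h (by omega))
  have harr : ψ (y * word x 0 1) = ψ (y * x .h ^ (s / 2)) * c := by
    have := hy _ (H.sq_arrow_add_mem_Kspan hk hs hsev hc)
    rw [mul_add, map_add, mul_smul_comm, map_smul, smul_eq_mul, mul_comm c] at this
    exact CharTwo.add_eq_zero.mp this
  have hcast : ¬ (((3 * k - 1 : ℕ) : ZMod 3) = 0) := by
    rw [cast_three_mul_sub_one hk]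
    decide
  have e := H.expansion P hk hs y
  rw [hw (t := 2) (m := 3 * k) (by omega) (fun _ => by omega) (by omega),
    hw (t := 1) (m := 3 * k) (by omega) (fun _ => by omega) (by omega),
    hw (t := 2) (m := 3 * k - 1) (by omega) (fun h => absurd h hcast)
      (fun h => absurd h.1 (by decide)), H.word_one_top hk] at e
  have e' : y = ψ (y * eps x 0) • word x 2 (3 * k) + ψ (y * eps x 1) • x .h ^ s +
      (∑ m ∈ Finset.Icc 1 (3 * k - 1), ∑ t : ZMod 3,
        ψ (y * word x (t - m) (3 * k - m)) • word x t m -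
          ψ (y * word x 0 1) • word x 2 (3 * k - 1)) +
      (∑ j ∈ Finset.Icc 1 (s - 1), ψ (y * x .h ^ (s - j)) • x .h ^ j -
        ψ (y * x .h ^ (s / 2)) • x .h ^ (s / 2)) +
      ψ (y * x .h ^ (s / 2)) • (x .h ^ (s / 2) + c • word x 2 (3 * k - 1)) := by
    rw [smul_add, smul_smul, ← harr]
    nth_rw 1 [e]
    simp only [zero_smul, mul_zero, sub_zero, zero_add]
    abel
  rw [e']
  exact add_mem (add_mem (add_mem (add_mem (W.smul_mem _ htop)
    (W.smul_mem _ (hpow (by omega) le_rfl))) hS) hQ) (W.smul_mem _ hspecial)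

end Form

end IsDihedral

namespace IsDihedral

variable {x : Gen → A} (H : IsDihedral k s c x)
include H

section Form

variable {ψ : A →ₗ[F] F} (P : IsSocleForm k s x ψ)
include P

lemma map_top_mul_eps_eq (t u : ZMod 3) :
    ψ (word x t (3 * k) * eps x u) = if u = 1 ↔ t = 1 then 1 else 0 := by
  rw [← H.eps_mul_word_three, H.eps_mul_word_three_eq]
  split_ifs
  · exact P.word_top t
  · exact map_zero ψ

theorem linearIndependent_reynoldsBasis (hk : 1 ≤ k) (hkodd : Odd k) (hs : 2 ≤ s) (hsev : Even s) :
    LinearIndependent F (fun p : reynoldsBasis k s c x => (p : A)) := by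
  have hs1 : 1 ≤ s := by omega
  obtain ⟨d, hd⟩ := hsev
  obtain ⟨l, hl⟩ := hkodd
  suffices h : ∀ p ∈ reynoldsBasis k s c x, ∃ v : A, ψ (p * v) ≠ 0 ∧
      ∀ q ∈ reynoldsBasis k s c x, q ≠ p → ψ (q * v) = 0 by
    refine linearIndependent_of_dual fun p hp => ?_
    obtain ⟨v, hv⟩ := h p hp
    exact ⟨ψ ∘ₗ LinearMap.mulRight F v, hv⟩
  have hspecial_eps (u : ZMod 3) :
      ψ ((x .h ^ (s / 2) + c • word x 2 (3 * k - 1)) * eps x u) = 0 := by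
    rw [add_mul, map_add, H.map_pow_mul_eps P u (by omega) (by omega), smul_mul_assoc, map_smul,
      H.map_word_mul_eps P _ _ (by omega), smul_zero, add_zero]
  have hspecial_pow {j : ℕ} (hj : 1 ≤ j) :
      ψ ((x .h ^ (s / 2) + c • word x 2 (3 * k - 1)) * x .h ^ j) =
        if s / 2 + j = s then 1 else 0 := by
    rw [add_mul, smul_mul_assoc, H.word_mul_pow 2 hj (by omega), smul_zero, add_zero, ← pow_add,
      H.map_pow P hk (by omega)]
  have hrot_pow {i j : ℕ} (hi : 1 ≤ i) (hj : 1 ≤ j) : rot x i * x .h ^ j = 0 := by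
    simp only [rot, add_mul, H.word_mul_pow _ hj (show 1 ≤ 3 * i by omega), add_zero]
  rintro p (((hp | ⟨i, hi, rfl⟩) | hp) | ⟨j, hj, rfl⟩)
  · rw [Set.mem_singleton_iff] at hp
    subst hp
    refine ⟨x .h ^ (s / 2), ?_, ?_⟩
    · rw [hspecial_pow (by omega), if_pos (by omega)]
      exact one_ne_zero
    rintro q (((hq | ⟨i, hi, rfl⟩) | hq) | ⟨j, hj, rfl⟩) hqp
    · exact absurd hq hqp
    · rw [Set.mem_Icc] at hi
      rw [hrot_pow (by omega) (by omega), map_zero]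
    · rw [Set.mem_singleton_iff.mp hq, H.word_mul_pow 2 (by omega) (by omega), map_zero]
    · rw [Set.mem_Icc] at hj
      dsimp only
      rw [← pow_add, H.map_pow P hk (by omega), if_neg (by omega)]
  · rw [Set.mem_Icc] at hi
    have hval {i' : ℕ} (h : 1 ≤ i') : ψ (rot x i' * word x 2 (3 * (k - i))) =
        if 3 * (k - i) + 3 * i' = 3 * k then 1 else 0 := by
      rw [H.rot_mul_word hk hs1 2 h (by omega), H.map_word P hk hs1]
    refine ⟨word x 2 (3 * (k - i)), ?_, ?_⟩
    · rw [hval (by omega), if_pos (by omega)]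
      exact one_ne_zero
    rintro q (((hq | ⟨i', hi', rfl⟩) | hq) | ⟨j, hj, rfl⟩) hqp
    · rw [Set.mem_singleton_iff.mp hq, add_mul, H.pow_mul_word 2 (by omega) (by omega), zero_add,
        smul_mul_assoc, map_smul, H.map_word_mul_word P hk hs1 _ _ (by omega) (by omega),
        cast_three_mul, if_pos (sub_zero _).symm, if_neg (by omega), smul_zero]
    · rw [Set.mem_Icc] at hi'
      rw [hval (by omega), if_neg]
      intro h
      exact hqp (congrArg _ (by omega))
    · rw [Set.mem_singleton_iff.mp hq, H.top_mul_word hk hs1 _ _ (by omega), map_zero]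
    · rw [Set.mem_Icc] at hj
      dsimp only
      rw [H.pow_mul_word 2 (by omega) (by omega), map_zero]
  · rw [Set.mem_singleton_iff] at hp
    subst hp
    refine ⟨eps x 0, ?_, ?_⟩
    · rw [H.map_top_mul_eps_eq P, if_pos (by decide)]
      exact one_ne_zero
    rintro q (((hq | ⟨i, hi, rfl⟩) | hq) | ⟨j, hj, rfl⟩) hqp
    · rw [Set.mem_singleton_iff.mp hq, hspecial_eps]
    · rw [Set.mem_Icc] at hi
      rw [H.map_rot_mul_eps P (by omega)]
    · exact absurd hq hqp
    · rw [Set.mem_Icc] at hj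
      dsimp only
      rcases hj.2.eq_or_lt with rfl | h
      · rw [← H.word_one_top hk, H.map_top_mul_eps_eq P, if_neg (by decide)]
      · rw [H.map_pow_mul_eps P 0 (by omega) h]
  · rw [Set.mem_Icc] at hj
    dsimp only
    rcases hj.2.eq_or_lt with rfl | hlt
    · refine ⟨eps x 1, ?_, ?_⟩
      · rw [← H.word_one_top hk, H.map_top_mul_eps_eq P, if_pos Iff.rfl]
        exact one_ne_zero
      rintro q (((hq | ⟨i, hi, rfl⟩) | hq) | ⟨j', hj', rfl⟩) hqp
      · rw [Set.mem_singleton_iff.mp hq, hspecial_eps]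
      · rw [Set.mem_Icc] at hi
        rw [H.map_rot_mul_eps P (by omega)]
      · rw [Set.mem_singleton_iff.mp hq, H.map_top_mul_eps_eq P, if_neg (by decide)]
      · rw [Set.mem_Icc] at hj'
        have h : j' ≠ j := fun h => hqp (congrArg _ h)
        exact H.map_pow_mul_eps P 1 (by omega) (by omega)
    · refine ⟨x .h ^ (s - j), ?_, ?_⟩
      · rw [← pow_add, H.map_pow P hk (by omega), if_pos (by omega)]
        exact one_ne_zero
      rintro q (((hq | ⟨i, hi, rfl⟩) | hq) | ⟨j', hj', rfl⟩) hqp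
      · rw [Set.mem_singleton_iff.mp hq, hspecial_pow (by omega), if_neg (by omega)]
      · rw [Set.mem_Icc] at hi
        rw [hrot_pow (by omega) (by omega), map_zero]
      · rw [Set.mem_singleton_iff.mp hq, H.word_mul_pow 2 (by omega) (by omega), map_zero]
      · rw [Set.mem_Icc] at hj'
        have h : j' ≠ j := fun h => hqp (congrArg _ h)
        dsimp only
        rw [← pow_add, H.map_pow P hk (by omega), if_neg (by omega)]

end Form

end IsDihedral

end Abstract

section Presentation

variable {F k s c}

/-- The generators of `A^{k,s}_c`. -/
def dihedralGen (k s : ℕ) (c : F) (t : Gen) : DA F k s c := mk F k s c (gen F t)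

lemma mk_eq_mk {u v : FreeAlgebra F Gen} (h : Rel F k s c u v) : mk F k s c u = mk F k s c v :=
  RingQuot.mkAlgHom_rel F h

theorem isDihedral_dihedralGen (k s : ℕ) (c : F) : IsDihedral k s c (dihedralGen k s c) where
  unit := by simpa [dihedralGen] using mk_eq_mk (.unit : Rel F k s c _ _)
  idem1 := by simpa [dihedralGen] using mk_eq_mk (.idem1 : Rel F k s c _ _)
  idem2 := by simpa [dihedralGen] using mk_eq_mk (.idem2 : Rel F k s c _ _)
  orth12 := by simpa [dihedralGen] using mk_eq_mk (.orth12 : Rel F k s c _ _)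
  orth21 := by simpa [dihedralGen] using mk_eq_mk (.orth21 : Rel F k s c _ _)
  aL := by simpa [dihedralGen] using mk_eq_mk (.aL : Rel F k s c _ _)
  aR := by simpa [dihedralGen] using mk_eq_mk (.aR : Rel F k s c _ _)
  bL := by simpa [dihedralGen] using mk_eq_mk (.bL : Rel F k s c _ _)
  bR := by simpa [dihedralGen] using mk_eq_mk (.bR : Rel F k s c _ _)
  gL := by simpa [dihedralGen] using mk_eq_mk (.gL : Rel F k s c _ _)
  gR := by simpa [dihedralGen] using mk_eq_mk (.gR : Rel F k s c _ _)
  hL := by simpa [dihedralGen] using mk_eq_mk (.hL : Rel F k s c _ _)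
  hR := by simpa [dihedralGen] using mk_eq_mk (.hR : Rel F k s c _ _)
  bh := by simpa [dihedralGen] using mk_eq_mk (.bh : Rel F k s c _ _)
  hg := by simpa [dihedralGen] using mk_eq_mk (.hg : Rel F k s c _ _)
  gb := by simpa [dihedralGen] using mk_eq_mk (.gb : Rel F k s c _ _)
  asq := by simpa [dihedralGen] using mk_eq_mk (.asq : Rel F k s c _ _)
  abg := by simpa [dihedralGen] using mk_eq_mk (.abg : Rel F k s c _ _)
  hs := by simpa [dihedralGen] using mk_eq_mk (.hs : Rel F k s c _ _)
  adjoin_eq := by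
    have h1 : Set.range (dihedralGen k s c) = mk F k s c '' Set.range (FreeAlgebra.ι F) := by
      rw [← Set.range_comp]
      rfl
    rw [h1, ← AlgHom.map_adjoin, FreeAlgebra.adjoin_range_ι, Algebra.map_top,
      AlgHom.range_eq_top]
    exact RingQuot.mkAlgHom_surjective F (Rel F k s c)

section Paths

variable (k s c)

lemma word_two_eq (i : ℕ) (hi : 1 ≤ i) : word (dihedralGen k s c) 2 (3 * i) = ABG F k s c ^ i := by
  have H := isDihedral_dihedralGen k s c
  rw [H.word_three_mul 2 hi, H.word_two_three]; rfl

lemma word_zero_eq (i : ℕ) (hi : 1 ≤ i) : word (dihedralGen k s c) 0 (3 * i) = BGA F k s c ^ i := by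
  have H := isDihedral_dihedralGen k s c
  rw [H.word_three_mul 0 hi, H.word_zero_three]; rfl

lemma word_one_eq (i : ℕ) (hi : 1 ≤ i) : word (dihedralGen k s c) 1 (3 * i) = GAB F k s c ^ i := by
  have H := isDihedral_dihedralGen k s c
  rw [H.word_three_mul 1 hi, H.word_one_three]; rfl

lemma word_arr_one (t : ZMod 3) :
    word (dihedralGen k s c) t 1 = arr (dihedralGen k s c) t := by
  have H := isDihedral_dihedralGen k s c
  simp [word_succ, H.arr_eps]

lemma word_arr_two (t : ZMod 3) :
    word (dihedralGen k s c) t 2 =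
      arr (dihedralGen k s c) (t - 1) * arr (dihedralGen k s c) t := by
  rw [show 2 = 1 + 1 from rfl, word_succ, word_arr_one, Nat.cast_one]

lemma word_two_mem_BB (m : ℕ) (hm : m < 3 * k) : word (dihedralGen k s c) 2 m ∈ BB F k s c := by
  have H := isDihedral_dihedralGen k s c
  obtain ⟨i, r, hr, rfl⟩ : ∃ i r, r < 3 ∧ m = r + 3 * i :=
    ⟨m / 3, m % 3, Nat.mod_lt _ (by omega), by omega⟩
  interval_cases r <;> rcases Nat.eq_zero_or_pos i with rfl | hi
  · left; left; left; left; left; left; left; left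
    rfl
  · rw [zero_add, word_two_eq k s c i hi]
    left; left; left; left; left; left; right
    exact ⟨i, ⟨hi, by omega⟩, rfl⟩
  · rw [mul_zero, add_zero, word_arr_one]
    left; right; left; left; left
    rfl
  · rw [← H.word_mul' (u := 1) (by decide), word_one_eq k s c i hi, word_arr_one]
    left; right; left; right
    exact ⟨i, ⟨hi, by omega⟩, rfl⟩
  · rw [mul_zero, add_zero, word_arr_two]
    left; left; left; left; left; left; left; right; right; left
    rfl
  · rw [← H.word_mul' (u := 0) (by decide), word_zero_eq k s c i hi, word_arr_two]
    left; left; left; right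
    exact ⟨i, ⟨hi, by omega⟩, rfl⟩

lemma word_zero_mem_BB (m : ℕ) (hm : m < 3 * k) : word (dihedralGen k s c) 0 m ∈ BB F k s c := by
  have H := isDihedral_dihedralGen k s c
  obtain ⟨i, r, hr, rfl⟩ : ∃ i r, r < 3 ∧ m = r + 3 * i :=
    ⟨m / 3, m % 3, Nat.mod_lt _ (by omega), by omega⟩
  interval_cases r <;> rcases Nat.eq_zero_or_pos i with rfl | hi
  · left; left; left; left; left; left; left; left
    rfl
  · rw [zero_add, word_zero_eq k s c i hi]
    left; left; left; left; right
    exact ⟨i, ⟨hi, by omega⟩, rfl⟩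
  · rw [mul_zero, add_zero, word_arr_one]
    left; left; left; left; left; left; left; right; left
    rfl
  · rw [← H.word_mul' (u := 2) (by decide), word_two_eq k s c i hi, word_arr_one]
    left; left; left; left; left; right
    exact ⟨i, ⟨hi, by omega⟩, rfl⟩
  · rw [mul_zero, add_zero, word_arr_two]
    left; right; left; left; right
    rfl
  · rw [← H.word_mul' (u := 1) (by decide), word_one_eq k s c i hi, word_arr_two]
    left; right; right
    exact ⟨i, ⟨hi, by omega⟩, rfl⟩

lemma word_one_mem_BB (m : ℕ) (hm : m < 3 * k) : word (dihedralGen k s c) 1 m ∈ BB F k s c := by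
  have H := isDihedral_dihedralGen k s c
  obtain ⟨i, r, hr, rfl⟩ : ∃ i r, r < 3 ∧ m = r + 3 * i :=
    ⟨m / 3, m % 3, Nat.mod_lt _ (by omega), by omega⟩
  interval_cases r <;> rcases Nat.eq_zero_or_pos i with rfl | hi
  · right; left; left
    rfl
  · rw [zero_add, word_one_eq k s c i hi]
    right; left; right
    exact ⟨i, ⟨hi, by omega⟩, rfl⟩
  · rw [mul_zero, add_zero, word_arr_one]
    left; left; right; left; left; left
    rfl
  · rw [← H.word_mul' (u := 0) (by decide), word_zero_eq k s c i hi, word_arr_one]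
    left; left; right; left; right
    exact ⟨i, ⟨hi, by omega⟩, rfl⟩
  · rw [mul_zero, add_zero, word_arr_two]
    left; left; right; left; left; right
    rfl
  · rw [← H.word_mul' (u := 2) (by decide), word_two_eq k s c i hi, word_arr_two]
    left; left; right; right
    exact ⟨i, ⟨hi, by omega⟩, rfl⟩

lemma pow_mem_BB {j : ℕ} (h1 : 1 ≤ j) (hj : j ≤ s) : dihedralGen k s c .h ^ j ∈ BB F k s c := by
  right; right
  exact ⟨j, ⟨h1, hj⟩, rfl⟩

end Paths

theorem SoclePsi.isSocleForm {ψ : DA F k s c →ₗ[F] F} (hψ : SoclePsi F k s c ψ) (hk : 1 ≤ k)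
    (hs : 1 ≤ s) : IsSocleForm k s (dihedralGen k s c) ψ := by
  have H := isDihedral_dihedralGen k s c
  have h2 : ψ (word (dihedralGen k s c) 2 (3 * k)) = 1 := by
    refine (hψ _ ?_).1 (H.top_mem_socle hk hs 2)
    rw [word_two_eq k s c k hk]
    left; left; left; left; left; left; left; right; right; right
    rfl
  have h1 : ψ (word (dihedralGen k s c) 1 (3 * k)) = 1 := by
    refine (hψ _ ?_).1 (H.top_mem_socle hk hs 1)
    rw [H.word_one_top hk]
    exact pow_mem_BB k s c hs le_rfl
  have htop (t : ZMod 3) : ψ (word (dihedralGen k s c) t (3 * k)) = 1 := by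
    rcases zmod3_cases t with rfl | rfl | rfl
    · rw [H.word_top hk, h2]
    · exact h1
    · exact h2
  have hne (t : ZMod 3) : word (dihedralGen k s c) t (3 * k) ≠ 0 := fun h => by
    have := htop t
    rw [h, map_zero] at this
    exact zero_ne_one this
  refine ⟨fun t m hm => (hψ _ ?_).2 (H.word_notMem_socle hk hs t (hne t) hm), htop,
    fun j hj hj' => (hψ _ (pow_mem_BB k s c hj hj'.le)).2
      (H.pow_notMem_socle hk hs (H.word_one_top hk ▸ hne 1) hj')⟩
  rcases zmod3_cases t with rfl | rfl | rfl
  · exact word_zero_mem_BB k s c m hm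
  · exact word_one_mem_BB k s c m hm
  · exact word_two_mem_BB k s c m hm

lemma TP_eq_reynoldsBasis (hk : 1 ≤ k) (hc : c = 0 ∨ c = 1) :
    TP F k s c = reynoldsBasis k s c (dihedralGen k s c) := by
  have H := isDihedral_dihedralGen k s c
  have h1 : Np F k s c = {dihedralGen k s c .h ^ (s / 2) +
      c • word (dihedralGen k s c) 2 (3 * k - 1)} := by
    rcases hc with rfl | rfl
    · rw [Np, if_pos rfl, zero_smul, add_zero]
      rfl
    · have h2 : word (dihedralGen k s (1 : F)) 2 (3 * k - 1) =
          BGA F k s 1 ^ (k - 1) * (Be F k s 1 * Ga F k s 1) := by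
        rcases hk.eq_or_lt with rfl | h
        · rw [Nat.sub_self, pow_zero, one_mul]
          exact word_arr_two 1 s 1 2
        · rw [← word_zero_eq k s 1 (k - 1) (by omega), show 3 * k - 1 = 2 + 3 * (k - 1) by omega,
            ← H.word_mul' (u := 0) (by decide), word_arr_two]
          rfl
      rw [Np, if_neg one_ne_zero, one_smul, h2]
      rfl
  have h3 : (fun i => ABG F k s c ^ i + BGA F k s c ^ i + GAB F k s c ^ i) ''
      Set.Icc ((k + 1) / 2) (k - 1) =
      rot (dihedralGen k s c) '' Set.Icc ((k + 1) / 2) (k - 1) := by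
    refine Set.image_congr fun i hi => ?_
    have h : 1 ≤ i := by
      have := hi.1
      omega
    rw [rot, word_two_eq k s c i h, word_zero_eq k s c i h, word_one_eq k s c i h]
  rw [TP, reynoldsBasis, h1, h3, word_two_eq k s c k hk]
  rfl

end Presentation

/-- **Basis of the generalized Reynolds ideal `T₁(A^{k,s}_c)^⊥` (dihedral type,
`k` odd, `s` even).** -/
theorem dihedral_T1perp_basis_odd_even
    (F : Type) [Field F] [IsAlgClosed F] [CharP F 2]
    (k s : ℕ) (hk : 1 ≤ k) (hkodd : Odd k) (hs : 2 ≤ s) (hsev : Even s)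
    (c : F) (hc : c = 0 ∨ c = 1)
    (ψ : DA F k s c →ₗ[F] F) (hψ : SoclePsi F k s c ψ) :
    LinearIndependent F (fun p : (TP F k s c) => (p : DA F k s c)) ∧
    (Submodule.span F (TP F k s c) : Set (DA F k s c)) = T1perp F k s c ψ := by
  have H := isDihedral_dihedralGen k s c
  have P := hψ.isSocleForm hk (by omega)
  have hc' : c ^ 2 = c := by
    rcases hc with rfl | rfl <;> simp
  rw [TP_eq_reynoldsBasis hk hc]
  refine ⟨H.linearIndependent_reynoldsBasis P hk hkodd hs hsev, Set.Subset.antisymm ?_ ?_⟩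
  · intro y hy v hv
    induction (hy : y ∈ Submodule.span F _) using Submodule.span_induction with
    | mem y hy => exact H.map_mul_eq_zero P hk hkodd hs hsev hc' hy hv
    | zero => simp
    | add y z _ _ hy hz => rw [add_mul, map_add, hy, hz, add_zero]
    | smul r y _ hy => rw [smul_mul_assoc, map_smul, hy, smul_zero]
  · exact fun y hy => H.mem_span_of_orthogonal P hk hkodd hs hsev hc' fun v hv => hy v hv

end DihedralPaper

end
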